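/- arXiv:1603.05111 — 7 statements merged into one kernel-verified Lean document; each statement's English description precedes it below -/
import Mathlib

section
/- Let n ≥ 5 and let Â be an exceptional copositive n×n matrix with zeros û^1,…,û^n satisfying Supp û^j = I_j for all j, such that every zero of Â is proportional to one of û^1,…,û^n (minimal circulant zero support set). Then there exists a neighbourhood U of Â in the space of real symmetric n×n matrices with the property: every A ∈ U satisfying det A_{I_j} = 0 for all j = 1,…,n is an exceptional copositive matrix possessing zeros u^1,…,u^n with Supp u^j = I_j such that every zero of A is proportional to one of u^1,…,u^n. -/
open Matrix

/-- A real symmetric matrix is copositive if its quadratic form is nonnegative on the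
nonnegative orthant. -/
def Copositive {n : ℕ} (A : Matrix (Fin n) (Fin n) ℝ) : Prop :=
  ∀ x : Fin n → ℝ, (∀ i, 0 ≤ x i) → 0 ≤ x ⬝ᵥ A.mulVec x

/-- A copositive matrix is exceptional if it is not the sum of a positive semidefinite matrix
and a symmetric entrywise nonnegative matrix. -/
def Exceptional {n : ℕ} (A : Matrix (Fin n) (Fin n) ℝ) : Prop :=
  ¬ ∃ P N : Matrix (Fin n) (Fin n) ℝ,
      P.PosSemidef ∧ N.IsSymm ∧ (∀ i j, 0 ≤ N i j) ∧ A = P + N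

/-- A copositive matrix is extremal if in any decomposition into a sum of two copositive
matrices both summands are nonnegative multiples of it. -/
def ExtremalCopositive {n : ℕ} (A : Matrix (Fin n) (Fin n) ℝ) : Prop :=
  Copositive A ∧ ∀ A₁ A₂ : Matrix (Fin n) (Fin n) ℝ, Copositive A₁ → Copositive A₂ →
    A = A₁ + A₂ → ∃ c₁ c₂ : ℝ, 0 ≤ c₁ ∧ 0 ≤ c₂ ∧ A₁ = c₁ • A ∧ A₂ = c₂ • A

/-- A zero of a copositive matrix: a nonzero nonnegative vector on which the quadratic
form vanishes. -/
def IsZeroOf {n : ℕ} (A : Matrix (Fin n) (Fin n) ℝ) (u : Fin n → ℝ) : Prop :=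
  u ≠ 0 ∧ (∀ i, 0 ≤ u i) ∧ u ⬝ᵥ A.mulVec u = 0

/-- The support of a vector: the set of indices of its positive entries. -/
def supp {n : ℕ} (u : Fin n → ℝ) : Set (Fin n) := {i | 0 < u i}

/-- The embedding of `Fin (n-2)` into `Fin n` enumerating the cyclic index set
`I_j = {j, j+1, ..., j+(n-3)}` (0-based). -/
def circEmb (n : ℕ) (j : Fin n) : Fin (n - 2) → Fin n :=
  fun s => j + Fin.castLE (Nat.sub_le n 2) s

/-- The cyclic index set `I_j` of cardinality `n-2`. -/
def circIdx (n : ℕ) (j : Fin n) : Set (Fin n) := Set.range (circEmb n j)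

/-- The principal submatrix `A_{I_j}`. -/
def circSub {n : ℕ} (A : Matrix (Fin n) (Fin n) ℝ) (j : Fin n) :
    Matrix (Fin (n - 2)) (Fin (n - 2)) ℝ :=
  A.submatrix (circEmb n j) (circEmb n j)

/-- A minimal zero of a copositive matrix: a zero whose support does not strictly
contain the support of another zero. -/
def MinimalZero {n : ℕ} (A : Matrix (Fin n) (Fin n) ℝ) (u : Fin n → ℝ) : Prop :=
  IsZeroOf A u ∧ ∀ v, IsZeroOf A v → ¬ (supp v ⊂ supp u)

open Filter Topology

/-- A matrix with nonnegative form on the nonnegative orthant and a strictly positive zero has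
a nonnegative form. -/
lemma form_nonneg_of_pos_zero {m : Type*} [Fintype m] {M : Matrix m m ℝ}
    (hcop : ∀ x : m → ℝ, (∀ i, 0 ≤ x i) → 0 ≤ x ⬝ᵥ M *ᵥ x) {w : m → ℝ} (hw : ∀ i, 0 < w i)
    (hw0 : w ⬝ᵥ M *ᵥ w = 0) (x : m → ℝ) : 0 ≤ x ⬝ᵥ M *ᵥ x := by
  obtain ⟨ε, hε, h⟩ : ∃ ε : ℝ, 0 < ε ∧ ∀ i, ε * |x i| ≤ w i := by
    have hev : ∀ i, ∀ᶠ ε in 𝓝[>] (0 : ℝ), ε * |x i| < w i := fun i =>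
      ((continuous_id.mul continuous_const).tendsto' (0 : ℝ) (0 : ℝ) (by simp)
        |>.eventually_lt_const (hw i)).filter_mono nhdsWithin_le_nhds
    obtain ⟨ε, h, hε⟩ := ((eventually_all.2 hev).and self_mem_nhdsWithin).exists
    exact ⟨ε, hε, fun i => (h i).le⟩
  have hp := hcop (w + ε • x) fun i => by
    have := h i
    have := neg_abs_le (x i)
    simp only [Pi.add_apply, Pi.smul_apply, smul_eq_mul]
    nlinarith
  have hm := hcop (w - ε • x) fun i => by
    have := h i
    have := le_abs_self (x i)
    simp only [Pi.sub_apply, Pi.smul_apply, smul_eq_mul]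
    nlinarith
  simp only [mulVec_add, mulVec_sub, mulVec_smul, add_dotProduct, dotProduct_add,
    sub_dotProduct, dotProduct_sub, smul_dotProduct, dotProduct_smul, smul_eq_mul, hw0] at hp hm
  have : 0 ≤ ε ^ 2 * (x ⬝ᵥ M *ᵥ x) := by nlinarith
  exact nonneg_of_mul_nonneg_right this (by positivity)

lemma mulVec_eq_zero_of_form_eq_zero {m : Type*} [Fintype m] {M : Matrix m m ℝ}
    (hM : M.IsSymm) (hpsd : ∀ x : m → ℝ, 0 ≤ x ⬝ᵥ M *ᵥ x) {x : m → ℝ}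
    (hx : x ⬝ᵥ M *ᵥ x = 0) : M *ᵥ x = 0 := by
  have h : M.PosSemidef := .of_dotProduct_mulVec_nonneg ((conjTranspose_eq_transpose_of_trivial M).trans hM) hpsd
  simpa using (h.dotProduct_mulVec_zero_iff x).1 (by simpa using hx)

lemma dotProduct_mulVec_symm {m : Type*} [Fintype m] {M : Matrix m m ℝ} (hM : M.IsSymm)
    (x y : m → ℝ) : x ⬝ᵥ M *ᵥ y = y ⬝ᵥ M *ᵥ x := by
  rw [dotProduct_mulVec, ← mulVec_transpose, hM.eq, dotProduct_comm]

/-- If all zeros of a nonnegative form in the orthant are strictly positive, its kernel is a line. -/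
lemma eq_smul_of_form_eq_zero {m : Type*} [Fintype m] [Nonempty m] {M : Matrix m m ℝ}
    (hM : M.IsSymm) (hpsd : ∀ x : m → ℝ, 0 ≤ x ⬝ᵥ M *ᵥ x) {w : m → ℝ} (hw : ∀ i, 0 < w i)
    (hw0 : w ⬝ᵥ M *ᵥ w = 0)
    (hpos : ∀ x : m → ℝ, x ≠ 0 → (∀ i, 0 ≤ x i) → x ⬝ᵥ M *ᵥ x = 0 → ∀ i, 0 < x i)
    {x : m → ℝ} (hx : x ⬝ᵥ M *ᵥ x = 0) : ∃ c : ℝ, x = c • w := by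
  obtain ⟨k, hk⟩ := Finite.exists_min fun i => x i / w i
  refine ⟨x k / w k, ?_⟩
  by_contra hne
  have h := hpos (x - (x k / w k) • w) (sub_ne_zero.2 hne) (fun i => by
    have := (le_div_iff₀ (hw i)).1 (hk i)
    simpa using this) (by
    have h1 := mulVec_eq_zero_of_form_eq_zero hM hpsd hx
    have h2 := mulVec_eq_zero_of_form_eq_zero hM hpsd hw0
    simp [mulVec_sub, mulVec_smul, h1, h2]) k
  simp [(hw k).ne'] at h

lemma continuous_form {m : Type*} [Fintype m] :
    Continuous fun p : Matrix m m ℝ × (m → ℝ) => p.2 ⬝ᵥ p.1 *ᵥ p.2 :=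
  continuous_snd.dotProduct (continuous_fst.matrix_mulVec continuous_snd)

/-- Positive definiteness of the form on a coordinate hyperplane is an open condition. -/
lemma form_pos_eventually {m : Type*} [Fintype m] {M : Matrix m m ℝ} (k : m)
    (hM : ∀ x : m → ℝ, x k = 0 → x ≠ 0 → 0 < x ⬝ᵥ M *ᵥ x) :
    ∀ᶠ M' in 𝓝 M, ∀ x : m → ℝ, x k = 0 → x ≠ 0 → 0 < x ⬝ᵥ M' *ᵥ x := by
  have hK : IsCompact (Metric.sphere (0 : m → ℝ) 1 ∩ {x | x k = 0}) :=
    (isCompact_sphere 0 1).inter_right (isClosed_eq (continuous_apply k) continuous_const)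
  have := hK.eventually_forall_of_forall_eventually (x₀ := M)
    (P := fun M' x => 0 < x ⬝ᵥ M' *ᵥ x) fun x hx =>
      continuous_form.continuousAt.eventually_const_lt
        (hM x hx.2 (ne_zero_of_mem_unit_sphere ⟨x, hx.1⟩))
  filter_upwards [this] with M' h x hxk hx
  have hn : 0 < ‖x‖ := norm_pos_iff.2 hx
  have := h (‖x‖⁻¹ • x) ⟨by simp [norm_smul, hn.ne'], by simp [hxk]⟩
  simp only [mulVec_smul, smul_dotProduct, dotProduct_smul, smul_eq_mul] at this
  have := pos_of_mul_pos_right this (by positivity)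
  exact pos_of_mul_pos_right this (by positivity)

/-- If the kernel is a line through a strictly positive vector, then kernel vectors of nearby
matrices have entries of one strict sign. -/
lemma kernel_pos_eventually {m : Type*} [Fintype m] {M : Matrix m m ℝ} {w : m → ℝ}
    (hw : ∀ i, 0 < w i) (hker : ∀ x : m → ℝ, M *ᵥ x = 0 → ∃ c : ℝ, x = c • w) :
    ∀ᶠ M' in 𝓝 M, ∀ x : m → ℝ, x ≠ 0 → M' *ᵥ x = 0 → (∀ i, 0 < x i) ∨ ∀ i, x i < 0 := by
  have hcont : Continuous fun p : Matrix m m ℝ × (m → ℝ) => p.1 *ᵥ p.2 :=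
    continuous_fst.matrix_mulVec continuous_snd
  have := (isCompact_sphere (0 : m → ℝ) 1).eventually_forall_of_forall_eventually (x₀ := M)
    (P := fun M' x => M' *ᵥ x = 0 → (∀ i, 0 < x i) ∨ ∀ i, x i < 0) fun x hx => by
      have hx0 : x ≠ 0 := ne_zero_of_mem_unit_sphere ⟨x, hx⟩
      by_cases h : M *ᵥ x = 0
      · obtain ⟨c, rfl⟩ := hker x h
        have hc : c ≠ 0 := by rintro rfl; simp at hx0
        have hap : ∀ i, Continuous fun p : Matrix m m ℝ × (m → ℝ) => p.2 i := fun i =>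
          (continuous_apply i).comp continuous_snd
        rcases hc.lt_or_gt with hc | hc
        · filter_upwards [eventually_all.2 fun i => (hap i).continuousAt.eventually_lt_const
            (show (M, c • w).2 i < 0 from mul_neg_of_neg_of_pos hc (hw i))] with p hp _
          exact Or.inr hp
        · filter_upwards [eventually_all.2 fun i => (hap i).continuousAt.eventually_const_lt
            (show 0 < (M, c • w).2 i from mul_pos hc (hw i))] with p hp _
          exact Or.inl hp
      · filter_upwards [hcont.continuousAt.eventually_ne (y := 0) (x := (M, x)) h] with p hp hp'
        exact absurd hp' hp
  filter_upwards [this] with M' h x hx hxM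
  have hn : 0 < ‖x‖ := norm_pos_iff.2 hx
  have := h (‖x‖⁻¹ • x) (by simp [norm_smul, hn.ne']) (by simp [mulVec_smul, hxM])
  simpa [hn, mul_pos_iff, mul_neg_iff, hn.not_gt] using this

/-- A singular symmetric perturbation of a positive semidefinite matrix whose kernel is a line
through a strictly positive vector is of the same kind. -/
lemma singular_perturbation {m : Type*} [Fintype m] [DecidableEq m] [Nonempty m]
    {M : Matrix m m ℝ} (hpsd : ∀ x : m → ℝ, 0 ≤ x ⬝ᵥ M *ᵥ x) {w : m → ℝ}
    (hw : ∀ i, 0 < w i) (hker : ∀ x : m → ℝ, x ⬝ᵥ M *ᵥ x = 0 → ∃ c : ℝ, x = c • w) :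
    ∀ᶠ M' in 𝓝 M, M'.IsSymm → M'.det = 0 → (∀ x : m → ℝ, 0 ≤ x ⬝ᵥ M' *ᵥ x) ∧
      ∃ u : m → ℝ, (∀ i, 0 < u i) ∧ M' *ᵥ u = 0 ∧
        ∀ x : m → ℝ, x ⬝ᵥ M' *ᵥ x = 0 → ∃ c : ℝ, x = c • u := by
  obtain ⟨k⟩ := ‹Nonempty m›
  have h1 := form_pos_eventually (M := M) k fun x hxk hx =>
    (hpsd x).lt_of_ne' fun h0 => by
      obtain ⟨c, rfl⟩ := hker x h0
      rcases mul_eq_zero.1 (show c * w k = 0 from hxk) with rfl | h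
      · simp at hx
      · exact (hw k).ne' h
  have h2 := kernel_pos_eventually hw fun x hx => hker x (by rw [hx, dotProduct_zero])
  filter_upwards [h1, h2] with M' h1 h2 hs hdet
  obtain ⟨u, hu, huM⟩ : ∃ u : m → ℝ, (∀ i, 0 < u i) ∧ M' *ᵥ u = 0 := by
    obtain ⟨v, hv, hvM⟩ := exists_mulVec_eq_zero_iff.2 hdet
    rcases h2 v hv hvM with h | h
    · exact ⟨v, h, hvM⟩
    · exact ⟨-v, fun i => by simpa using h i, by simp [mulVec_neg, hvM]⟩
  have hform : ∀ x : m → ℝ, ∀ c : ℝ, (x - c • u) ⬝ᵥ M' *ᵥ (x - c • u) = x ⬝ᵥ M' *ᵥ x := by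
    intro x c
    have : u ⬝ᵥ M' *ᵥ x = 0 := by rw [dotProduct_mulVec_symm hs, huM, dotProduct_zero]
    simp [mulVec_sub, mulVec_smul, huM, sub_dotProduct, this]
  have hk : ∀ x : m → ℝ, (x - (x k / u k) • u) k = 0 := fun x => by simp [(hu k).ne']
  refine ⟨fun x => ?_, u, hu, huM, fun x hx => ⟨x k / u k, ?_⟩⟩
  · by_cases h : x - (x k / u k) • u = 0
    · rw [← hform x (x k / u k), h]; simp
    · rw [← hform x (x k / u k)]; exact (h1 _ (hk x) h).le
  · by_contra h
    have := h1 _ (hk x) (sub_ne_zero.2 h)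
    rw [hform, hx] at this
    exact this.false

lemma form_submatrix {m n : Type*} [Fintype m] [Fintype n] {e : m → n}
    (he : Function.Injective e) (A : Matrix n n ℝ) {x : n → ℝ}
    (hx : ∀ i ∉ Set.range e, x i = 0) :
    (x ∘ e) ⬝ᵥ A.submatrix e e *ᵥ (x ∘ e) = x ⬝ᵥ A *ᵥ x := by
  have hsum : ∀ f : n → ℝ, (∀ i ∉ Set.range e, f i = 0) → ∑ s, f (e s) = ∑ i, f i :=
    fun f hf => Fintype.sum_of_injective e he _ f hf fun _ => rfl
  simp only [dotProduct, mulVec, submatrix_apply, Function.comp_apply]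
  rw [← hsum _ fun i hi => by simp [hx i hi]]
  refine Finset.sum_congr rfl fun s _ => ?_
  rw [← hsum (fun i => A (e s) i * x i) fun i hi => by simp [hx i hi]]

/-- The zero extension of a vector along an injection. -/
lemma exists_extension {m n : Type*} {e : m → n} (he : Function.Injective e) (y : m → ℝ) :
    ∃ x : n → ℝ, x ∘ e = y ∧ ∀ i ∉ Set.range e, x i = 0 :=
  ⟨Function.extend e y 0, funext fun s => he.extend_apply y 0 s, fun i hi => by
    simp [Function.extend_apply' y (0 : n → ℝ) i hi]⟩

lemma mem_circIdx {n : ℕ} (j i : Fin n) : i ∈ circIdx n j ↔ (i.val + (n - j.val)) % n < n - 2 := by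
  obtain ⟨i, hi⟩ := i
  obtain ⟨j, hj⟩ := j
  simp only [circIdx, circEmb, Set.mem_range, Fin.ext_iff, Fin.val_add, Fin.val_castLE]
  constructor
  · rintro ⟨⟨s, hs⟩, h⟩
    simp only at h
    rcases lt_or_ge (j + s) n with h' | h'
    · rw [Nat.mod_eq_of_lt h'] at h
      rw [show i + (n - j) = s + n by omega, Nat.add_mod_right, Nat.mod_eq_of_lt (by omega)]
      exact hs
    · rw [Nat.mod_eq_sub_mod h', Nat.mod_eq_of_lt (by omega)] at h
      rw [show i + (n - j) = s by omega, Nat.mod_eq_of_lt (by omega)]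
      exact hs
  · intro h
    refine ⟨⟨_, h⟩, ?_⟩
    simp only [Nat.add_mod_mod]
    rw [show j + (i + (n - j)) = i + n by omega, Nat.add_mod_right, Nat.mod_eq_of_lt hi]

lemma mem_circIdx_iff {n : ℕ} (j i : Fin n) :
    i ∈ circIdx n j ↔ (j.val ≤ i.val ∧ i.val < j.val + (n - 2)) ∨ i.val + 2 < j.val := by
  have := i.isLt
  have := j.isLt
  rw [mem_circIdx]
  rcases lt_or_ge i.val j.val with h | h
  · rw [Nat.mod_eq_of_lt (by omega)]; omega
  · rw [Nat.mod_eq_sub_mod (by omega), Nat.mod_eq_of_lt (by omega)]; omega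

lemma circEmb_injective {n : ℕ} (j : Fin n) : Function.Injective (circEmb n j) := by
  intro s t h
  have : NeZero n := ⟨by have := j.isLt; omega⟩
  exact Fin.castLE_injective _ (add_left_cancel h)

lemma ncard_circIdx {n : ℕ} (j : Fin n) : (circIdx n j).ncard = n - 2 := by
  rw [circIdx, Set.ncard_range_of_injective (circEmb_injective j), Nat.card_eq_fintype_card,
    Fintype.card_fin]

lemma exists_mem_circIdx_pair {n : ℕ} (hn : 5 ≤ n) (i k : Fin n) :
    ∃ j, i ∈ circIdx n j ∧ k ∈ circIdx n j := by
  by_cases h : k ∈ circIdx n i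
  · exact ⟨i, by simp only [mem_circIdx_iff]; omega, h⟩
  · refine ⟨k, ?_, by simp only [mem_circIdx_iff]; omega⟩
    rw [mem_circIdx_iff] at h ⊢
    omega

lemma exists_adjacent_circIdx {n : ℕ} (hn : 5 ≤ n) {i j : Fin n} (h : i ∉ circIdx n j) :
    ∃ k, i ∈ circIdx n k ∧ circIdx n k ⊆ insert i (circIdx n j) := by
  have hi := i.isLt
  have hj := j.isLt
  by_cases h1 : i.val + 1 = j.val ∨ i.val + 1 = j.val + n
  · refine ⟨i, by rw [mem_circIdx_iff]; omega, fun l hl => ?_⟩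
    have := l.isLt
    rw [Set.mem_insert_iff, Fin.ext_iff]
    rw [mem_circIdx_iff] at *
    omega
  · by_cases h2 : j.val + 1 = n
    · refine ⟨⟨0, by omega⟩, ?_, fun l hl => ?_⟩
      · rw [mem_circIdx_iff] at *; simp only; omega
      · have := l.isLt
        rw [Set.mem_insert_iff, Fin.ext_iff]
        rw [mem_circIdx_iff] at *
        simp only at hl
        omega
    · refine ⟨⟨j.val + 1, by omega⟩, ?_, fun l hl => ?_⟩
      · rw [mem_circIdx_iff] at *; simp only; omega
      · have := l.isLt
        rw [Set.mem_insert_iff, Fin.ext_iff]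
        rw [mem_circIdx_iff] at *
        simp only at hl
        omega

lemma Copositive.mulVec_zero_nonneg {n : ℕ} {A : Matrix (Fin n) (Fin n) ℝ} (hA : A.IsSymm)
    (hcop : Copositive A) {u : Fin n → ℝ} (hu : IsZeroOf A u) (i : Fin n) : 0 ≤ (A *ᵥ u) i := by
  by_contra! h
  obtain ⟨ε, hε, hlt⟩ : ∃ ε : ℝ, 0 < ε ∧ 2 * (A *ᵥ u) i + ε * A i i < 0 := by
    have : ∀ᶠ ε in 𝓝[>] (0 : ℝ), 2 * (A *ᵥ u) i + ε * A i i < 0 :=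
      ((by fun_prop : Continuous fun ε : ℝ => 2 * (A *ᵥ u) i + ε * A i i).tendsto' 0
        (2 * (A *ᵥ u) i) (by simp) |>.eventually_lt_const (by linarith)).filter_mono
        nhdsWithin_le_nhds
    obtain ⟨ε, h, hε⟩ := (this.and self_mem_nhdsWithin).exists
    exact ⟨ε, hε, h⟩
  have hnn := hcop (u + ε • Pi.single i 1) fun l => by
    have h1 := hu.2.1 l
    have h2 : (0 : Fin n → ℝ) l ≤ (Pi.single i (1 : ℝ) : Fin n → ℝ) l :=
      (Pi.single_nonneg.2 zero_le_one : (0 : Fin n → ℝ) ≤ Pi.single i 1) l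
    have := mul_nonneg hε.le h2
    simp only [Pi.add_apply, Pi.smul_apply, smul_eq_mul]
    linarith
  have hsw := dotProduct_mulVec_symm hA u (Pi.single i 1)
  have hii : (Pi.single i 1 : Fin n → ℝ) ⬝ᵥ A *ᵥ Pi.single i 1 = A i i := by simp
  have hi : (Pi.single i 1 : Fin n → ℝ) ⬝ᵥ A *ᵥ u = (A *ᵥ u) i := by simp
  simp only [mulVec_add, mulVec_smul, add_dotProduct, dotProduct_add, smul_dotProduct,
    dotProduct_smul, smul_eq_mul, hu.2.2, hsw, hii, hi] at hnn
  nlinarith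

lemma supp_smul {n : ℕ} {c : ℝ} (hc : 0 < c) (u : Fin n → ℝ) : supp (c • u) = supp u := by
  ext i
  simp [supp, hc]

lemma pos_of_eq_smul {n : ℕ} {u v : Fin n → ℝ} {c : ℝ} (hu : ∀ i, 0 ≤ u i) (hv : ∀ i, 0 ≤ v i)
    (hv0 : v ≠ 0) (h : v = c • u) : 0 < c := by
  by_contra! hc
  refine hv0 (funext fun i => le_antisymm ?_ (hv i))
  rw [h]
  exact mul_nonpos_of_nonpos_of_nonneg hc (hu i)

lemma apply_eq_zero_of_supp {n : ℕ} {u : Fin n → ℝ} (hu : ∀ i, 0 ≤ u i) {S : Set (Fin n)}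
    (hS : supp u = S) {i : Fin n} (hi : i ∉ S) : u i = 0 := by
  subst hS
  exact le_antisymm (not_lt.1 hi) (hu i)

lemma form_circSub_nonneg {n : ℕ} {A : Matrix (Fin n) (Fin n) ℝ} (hcop : Copositive A)
    {j : Fin n} {y : Fin (n - 2) → ℝ} (hy : ∀ s, 0 ≤ y s) : 0 ≤ y ⬝ᵥ circSub A j *ᵥ y := by
  obtain ⟨x, rfl, hx⟩ := exists_extension (circEmb_injective j) y
  rw [circSub, form_submatrix (circEmb_injective j) A hx]
  refine hcop x fun i => ?_
  by_cases hi : i ∈ Set.range (circEmb n j)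
  · obtain ⟨s, rfl⟩ := hi
    exact hy s
  · exact (hx i hi).ge

lemma exists_supp_eq_circIdx {n : ℕ} {A : Matrix (Fin n) (Fin n) ℝ} {u : Fin n → Fin n → ℝ}
    (hu : ∀ j, IsZeroOf A (u j) ∧ supp (u j) = circIdx n j)
    (hmin : ∀ v, IsZeroOf A v → ∃ j : Fin n, ∃ c : ℝ, v = c • u j)
    {v : Fin n → ℝ} (hv : IsZeroOf A v) :
    ∃ j : Fin n, ∃ c : ℝ, 0 < c ∧ v = c • u j ∧ supp v = circIdx n j := by
  obtain ⟨j, c, h⟩ := hmin v hv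
  have hc := pos_of_eq_smul (hu j).1.2.1 hv.2.1 hv.1 h
  exact ⟨j, c, hc, h, by rw [h, supp_smul hc, (hu j).2]⟩

lemma IsZeroOf.comp_circEmb {n : ℕ} {A : Matrix (Fin n) (Fin n) ℝ} {u : Fin n → ℝ} {j : Fin n}
    (hu : IsZeroOf A u) (hs : supp u = circIdx n j) : (∀ s, 0 < (u ∘ circEmb n j) s) ∧
      (u ∘ circEmb n j) ⬝ᵥ circSub A j *ᵥ (u ∘ circEmb n j) = 0 := by
  refine ⟨fun s => ?_, ?_⟩
  · have : circEmb n j s ∈ supp u := hs ▸ Set.mem_range_self s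
    exact this
  · rw [circSub, form_submatrix (circEmb_injective j) A fun i hi =>
      apply_eq_zero_of_supp hu.2.1 hs hi]
    exact hu.2.2

/-- Minimality of the circulant zero support set forces every block to be positive semidefinite
with a one-dimensional kernel. -/
lemma circSub_kernel {n : ℕ} (hn : 5 ≤ n) {A : Matrix (Fin n) (Fin n) ℝ} (hA : A.IsSymm)
    (hcop : Copositive A) {u : Fin n → Fin n → ℝ}
    (hu : ∀ j, IsZeroOf A (u j) ∧ supp (u j) = circIdx n j)
    (hmin : ∀ v, IsZeroOf A v → ∃ j : Fin n, ∃ c : ℝ, v = c • u j) (j : Fin n) :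
    (∀ x, 0 ≤ x ⬝ᵥ circSub A j *ᵥ x) ∧
      ∀ x, x ⬝ᵥ circSub A j *ᵥ x = 0 → ∃ c : ℝ, x = c • (u j ∘ circEmb n j) := by
  have : Nonempty (Fin (n - 2)) := ⟨⟨0, by omega⟩⟩
  obtain ⟨hw, hw0⟩ := (hu j).1.comp_circEmb (hu j).2
  have hpsd := form_nonneg_of_pos_zero (fun x => form_circSub_nonneg hcop) hw hw0
  refine ⟨hpsd, fun x => eq_smul_of_form_eq_zero (hA.submatrix _) hpsd hw hw0 ?_⟩
  intro y hy hynn hy0 s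
  obtain ⟨v, rfl, hv⟩ := exists_extension (circEmb_injective j) y
  have hvz : IsZeroOf A v := by
    refine ⟨?_, fun i => ?_, ?_⟩
    · rintro rfl
      exact hy rfl
    · by_cases hi : i ∈ Set.range (circEmb n j)
      · obtain ⟨s, rfl⟩ := hi
        exact hynn s
      · exact (hv i hi).ge
    · rw [← form_submatrix (circEmb_injective j) A hv]
      exact hy0
  obtain ⟨k, c, -, -, hk⟩ := exists_supp_eq_circIdx hu hmin hvz
  have hsub : supp v ⊆ circIdx n j := fun i hi => by
    by_contra hi'
    exact (show 0 < v i from hi).ne' (hv i hi')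
  have heq : supp v = circIdx n j :=
    Set.eq_of_subset_of_ncard_le hsub (by rw [hk, ncard_circIdx, ncard_circIdx])
  exact (hvz.comp_circEmb heq).1 s

lemma circSub_comp_mulVec {n : ℕ} (A : Matrix (Fin n) (Fin n) ℝ) {x : Fin n → ℝ} {j : Fin n}
    (hx : ∀ i ∉ circIdx n j, x i = 0) (s : Fin (n - 2)) :
    (circSub A j *ᵥ (x ∘ circEmb n j)) s = (A *ᵥ x) (circEmb n j s) :=
  Fintype.sum_of_injective (circEmb n j) (circEmb_injective j) _
    (fun i => A (circEmb n j s) i * x i) (fun i hi => by simp [hx i hi]) fun _ => rfl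

/-- Minimality of the circulant zero support set forces strict complementarity. -/
lemma mulVec_pos_of_notMem {n : ℕ} (hn : 5 ≤ n) {A : Matrix (Fin n) (Fin n) ℝ} (hA : A.IsSymm)
    (hcop : Copositive A) {u : Fin n → Fin n → ℝ}
    (hu : ∀ j, IsZeroOf A (u j) ∧ supp (u j) = circIdx n j)
    (hmin : ∀ v, IsZeroOf A v → ∃ j : Fin n, ∃ c : ℝ, v = c • u j) {i j : Fin n}
    (hi : i ∉ circIdx n j) : 0 < (A *ᵥ u j) i := by
  refine (hcop.mulVec_zero_nonneg hA (hu j).1 i).lt_of_ne' fun h0 => ?_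
  obtain ⟨k, hik, hk⟩ := exists_adjacent_circIdx hn hi
  have hvan : ∀ l ∈ insert i (circIdx n j), (A *ᵥ u j) l = 0 := by
    rintro l (rfl | ⟨s, rfl⟩)
    · exact h0
    · rw [← circSub_comp_mulVec A fun i hi => apply_eq_zero_of_supp (hu j).1.2.1 (hu j).2 hi]
      exact congrFun (mulVec_eq_zero_of_form_eq_zero (hA.submatrix _)
        (circSub_kernel hn hA hcop hu hmin j).1 ((hu j).1.comp_circEmb (hu j).2).2) s
  have hcross : u k ⬝ᵥ A *ᵥ u j = 0 := Finset.sum_eq_zero fun l _ => by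
    by_cases hl : l ∈ circIdx n k
    · rw [hvan l (hk hl), mul_zero]
    · rw [apply_eq_zero_of_supp (hu k).1.2.1 (hu k).2 hl, zero_mul]
  have hpos : ∀ l, 0 < (u j + u k) l ↔ 0 < u j l ∨ 0 < u k l := fun l => by
    have h1 := (hu j).1.2.1 l
    have h2 := (hu k).1.2.1 l
    simp only [Pi.add_apply]
    constructor
    · intro h
      by_contra! h'
      linarith
    · rintro (h | h) <;> linarith
  have hsupp : supp (u j + u k) = insert i (circIdx n j) := by
    have : supp (u j + u k) = circIdx n j ∪ circIdx n k := by
      rw [← (hu j).2, ← (hu k).2]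
      exact Set.ext hpos
    rw [this]
    refine Set.Subset.antisymm (Set.union_subset (Set.subset_insert _ _) hk) ?_
    rintro l (rfl | hl)
    exacts [Or.inr hik, Or.inl hl]
  have hz : IsZeroOf A (u j + u k) := by
    refine ⟨fun h => ?_, fun l => add_nonneg ((hu j).1.2.1 l) ((hu k).1.2.1 l), ?_⟩
    · have : i ∈ supp (u j + u k) := hsupp ▸ Set.mem_insert _ _
      rw [h] at this
      exact lt_irrefl (0 : ℝ) this
    · simp only [mulVec_add, add_dotProduct, dotProduct_add, (hu j).1.2.2, (hu k).1.2.2, hcross,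
        dotProduct_mulVec_symm hA (u j) (u k), add_zero]
  obtain ⟨m, -, -, -, hm⟩ := exists_supp_eq_circIdx hu hmin hz
  have hcard := ncard_circIdx m
  rw [← hm, hsupp, Set.ncard_insert_of_notMem hi, ncard_circIdx] at hcard
  omega

lemma form_eq_add_sum {m : Type*} [Fintype m] {A : Matrix m m ℝ} (hA : A.IsSymm) (p q : m → ℝ) :
    (p + q) ⬝ᵥ A *ᵥ (p + q) = p ⬝ᵥ A *ᵥ p + ∑ i, q i * ((A *ᵥ (p + q)) i + (A *ᵥ p) i) := by
  have : ∑ i, q i * ((A *ᵥ (p + q)) i + (A *ᵥ p) i) = q ⬝ᵥ A *ᵥ (p + q) + q ⬝ᵥ A *ᵥ p := by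
    simp only [dotProduct, mul_add, Finset.sum_add_distrib]
  rw [this]
  simp only [mulVec_add, add_dotProduct, dotProduct_add, dotProduct_mulVec_symm hA p q]
  ring

/-- If the block of `A` on `S` has nonnegative form and the gradient is positive off `S`, then
the form is nonnegative at `x`, and a zero has support in `S`. -/
lemma form_nonneg_of_gradient_pos {m : Type*} [Fintype m] {A : Matrix m m ℝ} (hA : A.IsSymm)
    {S : Set m} {x : m → ℝ} (hx : ∀ i, 0 ≤ x i)
    (hS : 0 ≤ S.indicator x ⬝ᵥ A *ᵥ S.indicator x)
    (hg : ∀ i ∉ S, 0 < (A *ᵥ x) i ∧ 0 < (A *ᵥ S.indicator x) i) :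
    0 ≤ x ⬝ᵥ A *ᵥ x ∧ (x ⬝ᵥ A *ᵥ x = 0 → ∀ i ∉ S, x i = 0) := by
  have hdec := form_eq_add_sum hA (S.indicator x) (Sᶜ.indicator x)
  rw [Set.indicator_self_add_compl] at hdec
  have hterm : ∀ i, 0 ≤ Sᶜ.indicator x i * ((A *ᵥ x) i + (A *ᵥ S.indicator x) i) := fun i => by
    by_cases hi : i ∈ S
    · simp [hi]
    · rw [Set.indicator_of_mem (by exact hi)]
      exact mul_nonneg (hx i) (add_nonneg (hg i hi).1.le (hg i hi).2.le)
  have hsum := Finset.sum_nonneg fun i (_ : i ∈ Finset.univ) => hterm i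
  refine ⟨by rw [hdec]; exact add_nonneg hS hsum, fun h0 i hi => ?_⟩
  have h := (Finset.sum_eq_zero_iff_of_nonneg fun i _ => hterm i).1
    (by linarith : ∑ i, Sᶜ.indicator x i * ((A *ᵥ x) i + (A *ᵥ S.indicator x) i) = 0) i
    (Finset.mem_univ i)
  rw [Set.indicator_of_mem (by exact hi)] at h
  exact (mul_eq_zero.1 h).resolve_right (add_pos (hg i hi).1 (hg i hi).2).ne'

lemma form_indicator_circIdx {n : ℕ} (A : Matrix (Fin n) (Fin n) ℝ) (j : Fin n) (x : Fin n → ℝ) :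
    (x ∘ circEmb n j) ⬝ᵥ circSub A j *ᵥ (x ∘ circEmb n j) =
      (circIdx n j).indicator x ⬝ᵥ A *ᵥ (circIdx n j).indicator x := by
  rw [← form_submatrix (circEmb_injective j) A (x := (circIdx n j).indicator x)
    fun i hi => Set.indicator_of_notMem hi x]
  have : (circIdx n j).indicator x ∘ circEmb n j = x ∘ circEmb n j :=
    funext fun s => Set.indicator_of_mem (Set.mem_range_self s) x
  rw [this, circSub]

/-- A matrix with a zero on each `I_j` that is not in the kernel is exceptional. -/
lemma exceptional_of_circulant_zeros {n : ℕ} (hn : 5 ≤ n) {A : Matrix (Fin n) (Fin n) ℝ}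
    {u : Fin n → Fin n → ℝ} (hu : ∀ j, IsZeroOf A (u j) ∧ supp (u j) = circIdx n j)
    (hker : ∀ j, A *ᵥ u j ≠ 0) : Exceptional A := by
  rintro ⟨P, N, hP, -, hN, rfl⟩
  have hterm : ∀ j i k, 0 ≤ u j i * (N i k * u j k) := fun j i k =>
    mul_nonneg ((hu j).1.2.1 i) (mul_nonneg (hN i k) ((hu j).1.2.1 k))
  have hNu : ∀ j, u j ⬝ᵥ N *ᵥ u j = ∑ i, ∑ k, u j i * (N i k * u j k) := fun j => by
    simp only [dotProduct, mulVec, Finset.mul_sum]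
  have hsplit : ∀ j, u j ⬝ᵥ P *ᵥ u j = 0 ∧ u j ⬝ᵥ N *ᵥ u j = 0 := fun j => by
    have h0 := (hu j).1.2.2
    rw [add_mulVec, dotProduct_add] at h0
    have h1 : 0 ≤ u j ⬝ᵥ P *ᵥ u j := by simpa using hP.dotProduct_mulVec_nonneg (u j)
    have h2 : 0 ≤ u j ⬝ᵥ N *ᵥ u j := by
      rw [hNu]
      exact Finset.sum_nonneg fun i _ => Finset.sum_nonneg fun k _ => hterm j i k
    constructor <;> linarith
  have hN0 : N = 0 := by
    ext i k
    obtain ⟨j, hi, hk⟩ := exists_mem_circIdx_pair hn i k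
    rw [← (hu j).2] at hi hk
    have h := (hsplit j).2
    rw [hNu, Finset.sum_eq_zero_iff_of_nonneg fun i _ =>
      Finset.sum_nonneg fun k _ => hterm j i k] at h
    have h := (Finset.sum_eq_zero_iff_of_nonneg fun k _ => hterm j i k).1
      (h i (Finset.mem_univ i)) k (Finset.mem_univ k)
    have hi : 0 < u j i := hi
    have hk : 0 < u j k := hk
    simpa [hi.ne', hk.ne'] using h
  have j : Fin n := ⟨0, by omega⟩
  refine hker j ?_
  rw [hN0, add_zero]
  exact (hP.dotProduct_mulVec_zero_iff (u j)).1 (by simpa using (hsplit j).1)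

/-- Near a copositive matrix with minimal circulant zero support set, a matrix whose blocks have
nonnegative forms is copositive, its zeros are supported in some `I_j` and are not in the kernel. -/
lemma copositive_eventually {n : ℕ} (hn : 5 ≤ n) {A : Matrix (Fin n) (Fin n) ℝ} (hA : A.IsSymm)
    (hcop : Copositive A) {u : Fin n → Fin n → ℝ}
    (hu : ∀ j, IsZeroOf A (u j) ∧ supp (u j) = circIdx n j)
    (hmin : ∀ v, IsZeroOf A v → ∃ j : Fin n, ∃ c : ℝ, v = c • u j) :
    ∀ᶠ B in 𝓝 A, B.IsSymm → (∀ j x, 0 ≤ x ⬝ᵥ circSub B j *ᵥ x) →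
      Copositive B ∧ ∀ v, IsZeroOf B v → B *ᵥ v ≠ 0 ∧ ∃ j, ∀ i ∉ circIdx n j, v i = 0 := by
  have hcont : Continuous fun p : Matrix (Fin n) (Fin n) ℝ × (Fin n → ℝ) => p.1 *ᵥ p.2 :=
    continuous_fst.matrix_mulVec continuous_snd
  have hK : IsCompact (Metric.sphere (0 : Fin n → ℝ) 1 ∩ {x | ∀ i, 0 ≤ x i}) := by
    refine (isCompact_sphere 0 1).inter_right ?_
    simp only [Set.ofPred_forall]
    exact isClosed_iInter fun i => isClosed_le continuous_const (continuous_apply i)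
  have key := hK.eventually_forall_of_forall_eventually (x₀ := A)
    (P := fun B x => (∀ i, 0 ≤ x i) → B.IsSymm → (∀ j x, 0 ≤ x ⬝ᵥ circSub B j *ᵥ x) →
      0 ≤ x ⬝ᵥ B *ᵥ x ∧
        (x ⬝ᵥ B *ᵥ x = 0 → B *ᵥ x ≠ 0 ∧ ∃ j, ∀ i ∉ circIdx n j, x i = 0)) fun x hx => by
    have hx0 : x ≠ 0 := ne_zero_of_mem_unit_sphere ⟨x, hx.1⟩
    rcases (hcop x hx.2).eq_or_lt' with h | h
    · obtain ⟨j, c, hc, hxu, -⟩ := exists_supp_eq_circIdx hu hmin ⟨hx0, hx.2, h⟩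
      have hind : (circIdx n j).indicator x = x := by
        rw [Set.indicator_eq_self, hxu]
        intro i hi
        by_contra hi'
        exact hi (by simp [apply_eq_zero_of_supp (hu j).1.2.1 (hu j).2 hi'])
      have hpos : ∀ i ∉ circIdx n j, 0 < (A *ᵥ x) i := fun i hi => by
        rw [hxu, mulVec_smul]
        exact mul_pos hc (mulVec_pos_of_notMem hn hA hcop hu hmin hi)
      have hne : A *ᵥ x ≠ 0 := fun h => by
        obtain ⟨i, hi⟩ : ∃ i, i ∉ circIdx n j := by
          by_contra! hall
          have hcard := ncard_circIdx j
          rw [Set.eq_univ_of_forall hall, Set.ncard_univ, Nat.card_eq_fintype_card,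
            Fintype.card_fin] at hcard
          omega
        exact (hpos i hi).ne' (congrFun h i)
      have hindc : Continuous fun y : Fin n → ℝ => (circIdx n j).indicator y := by
        refine continuous_pi fun i => ?_
        by_cases hi : i ∈ circIdx n j
        · simpa only [Set.indicator_of_mem hi] using continuous_apply i
        · simpa only [Set.indicator_of_notMem hi] using continuous_const
      have hcont' : Continuous fun p : Matrix (Fin n) (Fin n) ℝ × (Fin n → ℝ) =>
          p.1 *ᵥ (circIdx n j).indicator p.2 :=
        continuous_fst.matrix_mulVec (hindc.comp continuous_snd)
      have hgrad : ∀ᶠ p in 𝓝 (A, x), ∀ i ∉ circIdx n j,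
          0 < (p.1 *ᵥ p.2) i ∧ 0 < (p.1 *ᵥ (circIdx n j).indicator p.2) i := by
        refine eventually_all.2 fun i => ?_
        by_cases hi : i ∈ circIdx n j
        · exact Eventually.of_forall fun p hi' => absurd hi hi'
        · have h1 := (((continuous_apply i).comp hcont).tendsto (A, x)).eventually_const_lt
            (hpos i hi)
          have h2 := (((continuous_apply i).comp hcont').tendsto (A, x)).eventually_const_lt
            (show 0 < (A *ᵥ (circIdx n j).indicator x) i from hind.symm ▸ hpos i hi)
          filter_upwards [h1, h2] with p h1 h2 _ using ⟨h1, h2⟩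
      filter_upwards [hgrad, (hcont.tendsto (A, x)).eventually_ne hne]
        with p hp hpne hnn hs hpsd
      have := form_nonneg_of_gradient_pos hs hnn
        (form_indicator_circIdx p.1 j p.2 ▸ hpsd j _) hp
      exact ⟨this.1, fun h0 => ⟨hpne, j, this.2 h0⟩⟩
    · filter_upwards [(continuous_form.tendsto (A, x)).eventually_const_lt h]
        with p hp _ _ _
      exact ⟨hp.le, fun h0 => absurd h0 hp.ne'⟩
  filter_upwards [key] with B hB hs hpsd
  have scale : ∀ v : Fin n → ℝ, v ≠ 0 → (∀ i, 0 ≤ v i) → 0 ≤ v ⬝ᵥ B *ᵥ v ∧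
      (v ⬝ᵥ B *ᵥ v = 0 → B *ᵥ v ≠ 0 ∧ ∃ j, ∀ i ∉ circIdx n j, v i = 0) := by
    intro v hv hvnn
    have hn : 0 < ‖v‖⁻¹ := inv_pos.2 (norm_pos_iff.2 hv)
    have hnn : ∀ i, 0 ≤ (‖v‖⁻¹ • v) i := fun i => mul_nonneg hn.le (hvnn i)
    have := hB (‖v‖⁻¹ • v) ⟨by simp [norm_smul, hv], hnn⟩ hnn hs hpsd
    simpa only [mulVec_smul, smul_dotProduct, dotProduct_smul, smul_eq_mul, Pi.smul_apply,
      mul_nonneg_iff_of_pos_left hn, mul_eq_zero, hn.ne', false_or, ne_eq, smul_eq_zero] using this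
  refine ⟨fun v hvnn => ?_, fun v hv => (scale v hv.1 hv.2.1).2 hv.2.2⟩
  by_cases hv : v = 0
  · simp [hv]
  · exact (scale v hv hvnn).1

theorem statement7 (n : ℕ) (hn : 5 ≤ n) (Ahat : Matrix (Fin n) (Fin n) ℝ)
    (hAhat : Ahat.IsSymm) (hcop : Copositive Ahat) (hexc : Exceptional Ahat)
    (uhat : Fin n → Fin n → ℝ)
    (hu : ∀ j, IsZeroOf Ahat (uhat j) ∧ supp (uhat j) = circIdx n j)
    (hmin : ∀ v, IsZeroOf Ahat v → ∃ j : Fin n, ∃ c : ℝ, v = c • uhat j) :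
    ∃ U ∈ nhds Ahat, ∀ A ∈ U, A.IsSymm → (∀ j : Fin n, (circSub A j).det = 0) →
      Copositive A ∧ Exceptional A ∧
      ∃ u : Fin n → Fin n → ℝ,
        (∀ j, IsZeroOf A (u j) ∧ supp (u j) = circIdx n j) ∧
        ∀ v, IsZeroOf A v → ∃ j : Fin n, ∃ c : ℝ, v = c • u j := by
  have hsub : ∀ j, Continuous fun B : Matrix (Fin n) (Fin n) ℝ => circSub B j := fun j =>
    continuous_id.matrix_submatrix _ _
  have : Nonempty (Fin (n - 2)) := ⟨⟨0, by omega⟩⟩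
  have hblocks := eventually_all.2 fun j => (hsub j).continuousAt.eventually
    (singular_perturbation
      (circSub_kernel hn hAhat hcop hu hmin j).1 ((hu j).1.comp_circEmb (hu j).2).1
      (circSub_kernel hn hAhat hcop hu hmin j).2)
  refine ⟨_, hblocks.and (copositive_eventually hn hAhat hcop hu hmin), ?_⟩
  rintro A ⟨hbl, hcp⟩ hA hdet
  have hbl := fun j => hbl j (hA.submatrix _) (hdet j)
  obtain ⟨hcopA, hzero⟩ := hcp hA fun j => (hbl j).1
  choose w hw hwM hwker using fun j => (hbl j).2
  choose u hu hu0 using fun j => exists_extension (circEmb_injective j) (w j)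
  have hval : ∀ j s, u j (circEmb n j s) = w j s := fun j => congrFun (hu j)
  have hzu : ∀ j, IsZeroOf A (u j) ∧ supp (u j) = circIdx n j := by
    intro j
    have hsupp : supp (u j) = circIdx n j := by
      ext i
      constructor
      · intro hi
        by_contra hi'
        exact (show 0 < u j i from hi).ne' (hu0 j i hi')
      · rintro ⟨s, rfl⟩
        exact (hw j s).trans_eq (hval j s).symm
    refine ⟨⟨fun h => ?_, fun i => ?_, ?_⟩, hsupp⟩
    · have := hw j ⟨0, by omega⟩
      rw [← hval, h] at this
      exact lt_irrefl (0 : ℝ) this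
    · by_cases hi : i ∈ circIdx n j
      · exact (hsupp.ge hi).le
      · exact (hu0 j i hi).ge
    · rw [← form_submatrix (circEmb_injective j) A (hu0 j), hu]
      exact (congrArg (w j ⬝ᵥ ·) (hwM j)).trans (dotProduct_zero _)
  refine ⟨hcopA, exceptional_of_circulant_zeros hn hzu fun j => (hzero _ (hzu j).1).1, u, hzu, ?_⟩
  intro v hv
  obtain ⟨j, hj⟩ := (hzero v hv).2
  obtain ⟨c, hc⟩ := hwker j (v ∘ circEmb n j)
    ((form_submatrix (circEmb_injective j) A hj).trans hv.2.2)
  refine ⟨j, c, funext fun i => ?_⟩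
  by_cases hi : i ∈ circIdx n j
  · obtain ⟨s, rfl⟩ := hi
    exact (congrFun hc s).trans (congrArg (c * ·) (hval j s).symm)
  · simp [hj i hi, hu0 j i hi]
end

section
/- Let n ≥ 5 and let u^1,…,u^n ∈ ℝⁿ be nonnegative vectors with Supp u^j = I_j for all j = 1,…,n. Let F be the set of copositive n×n matrices A with (u^j)ᵀAu^j = 0 for all j, let P be the set of positive semidefinite n×n matrices A with (u^j)ᵀAu^j = 0 for all j, and let U be the n×n matrix whose columns are u^1,…,u^n. Then the following are equivalent: (i) F = P and P contains a matrix of rank n−3; (ii) rank U = 3. -/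
open Matrix

lemma Copositive.mulVec_nonneg_of_isZero {n : ℕ} {A : Matrix (Fin n) (Fin n) ℝ}
    (hA : Copositive A) (hs : A.IsSymm) {v : Fin n → ℝ} (hv : ∀ i, 0 ≤ v i)
    (h0 : v ⬝ᵥ A.mulVec v = 0) (i : Fin n) : 0 ≤ A.mulVec v i := by
  by_contra! hneg
  have key : ∀ t : ℝ, 0 ≤ t → 0 ≤ 2 * t * A.mulVec v i + t ^ 2 * A i i := by
    intro t ht
    have h := hA (v + t • Pi.single i 1) fun k => by
      have hk : (0 : ℝ) ≤ (Pi.single i 1 : Fin n → ℝ) k := by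
        by_cases hki : k = i
        · subst hki; simp
        · simp [hki]
      simpa using add_nonneg (hv k) (mul_nonneg ht hk)
    have hc : v ⬝ᵥ A.mulVec (Pi.single i 1) = A.mulVec v i := by
      rw [dotProduct_mulVec, ← mulVec_transpose, hs.eq]; simp
    rw [mulVec_add, mulVec_smul, add_dotProduct, dotProduct_add, dotProduct_add, h0,
      dotProduct_smul, smul_dotProduct, smul_dotProduct, dotProduct_smul, hc] at h
    simp at h
    nlinarith
  have h1 := key (-A.mulVec v i / (|A i i| + 1)) (by
    apply div_nonneg <;> [linarith; positivity])
  set c := A.mulVec v i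
  have hd : 0 < |A i i| + 1 := by positivity
  have h2 : 2 * (-c / (|A i i| + 1)) * c + (-c / (|A i i| + 1)) ^ 2 * A i i
      = c ^ 2 / (|A i i| + 1) ^ 2 * (A i i - 2 * (|A i i| + 1)) := by
    field_simp
    ring
  rw [h2] at h1
  have h3 : 0 < c ^ 2 / (|A i i| + 1) ^ 2 := by
    have := sq_pos_of_neg hneg
    positivity
  nlinarith [le_abs_self (A i i), abs_nonneg (A i i)]

lemma Copositive.mulVec_eq_zero_of_mem_supp {n : ℕ} {A : Matrix (Fin n) (Fin n) ℝ}
    (hA : Copositive A) (hs : A.IsSymm) {v : Fin n → ℝ} (hv : ∀ i, 0 ≤ v i)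
    (h0 : v ⬝ᵥ A.mulVec v = 0) {i : Fin n} (hi : 0 < v i) : A.mulVec v i = 0 := by
  have h := (Finset.sum_eq_zero_iff_of_nonneg fun k _ =>
    mul_nonneg (hv k) (hA.mulVec_nonneg_of_isZero hs hv h0 k)).1 h0 i (Finset.mem_univ i)
  exact (mul_eq_zero.1 h).resolve_left hi.ne'

/-- A copositive matrix with a strictly positive kernel vector is positive semidefinite. -/
lemma Copositive.posSemidef_of_mulVec_eq_zero {n : ℕ} {A : Matrix (Fin n) (Fin n) ℝ}
    (hA : Copositive A) (hs : A.IsSymm) {w : Fin n → ℝ} (hw : ∀ i, 0 < w i)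
    (h0 : A.mulVec w = 0) : A.PosSemidef := by
  refine PosSemidef.of_dotProduct_mulVec_nonneg (by rw [IsHermitian, conjTranspose_eq_transpose_of_trivial, hs.eq]) fun x => ?_
  have hsum : ∀ i, |x i| / w i ≤ ∑ k, |x k| / w k := fun i =>
    Finset.single_le_sum (f := fun k => |x k| / w k)
      (fun k _ => div_nonneg (abs_nonneg _) (hw k).le) (Finset.mem_univ i)
  set t := ∑ k, |x k| / w k
  have h := hA (x + t • w) fun i => by
    have h1 := (div_le_iff₀ (hw i)).1 (hsum i)
    have h2 := neg_abs_le (x i)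
    simp only [Pi.add_apply, Pi.smul_apply, smul_eq_mul]
    linarith
  have hc : w ⬝ᵥ A.mulVec x = 0 := by
    rw [dotProduct_mulVec, ← mulVec_transpose, hs.eq, h0, zero_dotProduct]
  rw [mulVec_add, mulVec_smul, h0, smul_zero, add_zero, add_dotProduct, smul_dotProduct, hc,
    smul_zero, add_zero] at h
  simpa using h

lemma exists_posSemidef_mul_eq_zero {n k : ℕ} (U : Matrix (Fin n) (Fin k) ℝ) :
    ∃ A : Matrix (Fin n) (Fin n) ℝ, A.PosSemidef ∧ A * U = 0 ∧ A.rank = n - U.rank := by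
  have hr : Module.finrank ℝ (LinearMap.ker Uᵀ.mulVecLin) = n - U.rank := by
    have h := LinearMap.finrank_range_add_finrank_ker Uᵀ.mulVecLin
    rw [Module.finrank_fin_fun] at h
    have h2 : Module.finrank ℝ (LinearMap.range Uᵀ.mulVecLin) = U.rank := U.rank_transpose
    omega
  let b := Module.finBasisOfFinrankEq ℝ _ hr
  let N : Matrix (Fin (n - U.rank)) (Fin n) ℝ := Matrix.of fun k => (b k : Fin n → ℝ)
  have hN : N * U = 0 := by
    ext k l
    have h := congrFun (LinearMap.mem_ker.1 (b k).2) l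
    rw [mulVecLin_apply, mulVec_transpose] at h
    exact h
  have hli : LinearIndependent ℝ N.row :=
    b.linearIndependent.map' (Submodule.subtype _) (Submodule.ker_subtype _)
  refine ⟨Nᵀ * N, by simpa using posSemidef_conjTranspose_mul_self N, ?_, ?_⟩
  · rw [Matrix.mul_assoc, hN, Matrix.mul_zero]
  · rw [rank_transpose_mul_self, hli.rank_matrix, Fintype.card_fin]

lemma mem_circIdx_add_iff {m : ℕ} (j d : Fin (m + 5)) :
    j + d ∈ circIdx (m + 5) j ↔ d.val < m + 3 := by
  constructor
  · rintro ⟨s, hs⟩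
    rw [← add_left_cancel (a := j) hs]
    exact s.2
  · intro h
    exact ⟨⟨d.val, h⟩, rfl⟩

lemma add_ofNat_add_ofNat {m : ℕ} (i : Fin (m + 5)) (a b : ℕ) :
    i + Fin.ofNat (m + 5) a + Fin.ofNat (m + 5) b = i + Fin.ofNat (m + 5) (a + b) := by
  ext
  simp [Fin.val_add, add_assoc]

lemma mem_circIdx_self {m : ℕ} (i : Fin (m + 5)) : i ∈ circIdx (m + 5) i := by
  simpa using (mem_circIdx_add_iff i 0).2 (by simp)

lemma mem_circIdx_add_ofNat_iff {m : ℕ} (i : Fin (m + 5)) {k : ℕ} (h0 : 0 < k)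
    (hk : k ≤ m + 5) : i ∈ circIdx (m + 5) (i + Fin.ofNat (m + 5) k) ↔ 3 ≤ k := by
  have hi : i + Fin.ofNat (m + 5) k + Fin.ofNat (m + 5) (m + 5 - k) = i := by
    rw [add_ofNat_add_ofNat, Nat.add_sub_cancel' hk]
    simp
  have h := mem_circIdx_add_iff (i + Fin.ofNat (m + 5) k) (Fin.ofNat (m + 5) (m + 5 - k))
  rw [hi] at h
  rw [h, Fin.val_ofNat, Nat.mod_eq_of_lt (by omega)]
  omega

section CirculantSupport

variable {m : ℕ} {u : Fin (m + 5) → Fin (m + 5) → ℝ}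

lemma linearIndependent_consecutive (hnn : ∀ j i, 0 ≤ u j i)
    (hsupp : ∀ j, supp (u j) = circIdx (m + 5) j) (i : Fin (m + 5)) :
    LinearIndependent ℝ fun k : Fin 3 => u (i + Fin.ofNat (m + 5) (3 + k)) := by
  have pos_iff : ∀ j i, 0 < u j i ↔ i ∈ circIdx (m + 5) j := fun j i => by
    rw [← hsupp]; rfl
  have zero : ∀ {r k}, 0 < k → k < 3 → u (r + Fin.ofNat (m + 5) k) r = 0 := by
    intro r k h0 h3
    refine le_antisymm (not_lt.1 ?_) (hnn _ _)
    rw [pos_iff, mem_circIdx_add_ofNat_iff r h0 (by omega)]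
    omega
  have pos3 : ∀ r, 0 < u (r + Fin.ofNat (m + 5) 3) r := fun r =>
    (pos_iff _ _).2 ((mem_circIdx_add_ofNat_iff r (by omega) (by omega)).2 le_rfl)
  have pos0 : ∀ r, 0 < u r r := fun r => (pos_iff _ _).2 (mem_circIdx_self r)
  rw [Fintype.linearIndependent_iff]
  intro g hg
  simp only [Fin.sum_univ_three, Fin.val_zero, Fin.val_one, Fin.val_two] at hg
  norm_num only at hg
  have e : ∀ a b, i + Fin.ofNat (m + 5) (a + b)
      = i + Fin.ofNat (m + 5) a + Fin.ofNat (m + 5) b := fun a b =>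
    (add_ofNat_add_ofNat i a b).symm
  have h2 := congrFun hg (i + Fin.ofNat (m + 5) 2)
  have h3 := congrFun hg (i + Fin.ofNat (m + 5) 3)
  have h4 := congrFun hg (i + Fin.ofNat (m + 5) 4)
  simp only [Pi.add_apply, Pi.smul_apply, smul_eq_mul, Pi.zero_apply] at h2 h3 h4
  have hg2 : g 2 = 0 := by
    rw [e 2 1, e 2 2, e 2 3, zero (by omega) (by omega), zero (by omega) (by omega)] at h2
    simpa only [mul_zero, zero_add, mul_eq_zero, (pos3 _).ne', or_false] using h2
  have hg0 : g 0 = 0 := by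
    rw [e 3 1, e 3 2, zero (by omega) (by omega), zero (by omega) (by omega)] at h3
    simpa only [mul_zero, add_zero, mul_eq_zero, (pos0 _).ne', or_false] using h3
  have hg1 : g 1 = 0 := by
    simpa only [hg0, hg2, zero_mul, zero_add, add_zero, mul_eq_zero, (pos0 _).ne', or_false]
      using h4
  intro k
  fin_cases k <;> assumption

lemma mul_eq_zero_of_copositive (hnn : ∀ j i, 0 ≤ u j i)
    (hsupp : ∀ j, supp (u j) = circIdx (m + 5) j)
    (hr : (Matrix.of fun i j => u j i).rank = 3) {A : Matrix (Fin (m + 5)) (Fin (m + 5)) ℝ}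
    (hA : Copositive A) (hs : A.IsSymm) (h0 : ∀ j, u j ⬝ᵥ A.mulVec (u j) = 0)
    (j : Fin (m + 5)) : A.mulVec (u j) = 0 := by
  ext i
  set v : Fin 3 → Fin (m + 5) → ℝ := fun k => u (i + Fin.ofNat (m + 5) (3 + k)) with hv
  have hspan : Submodule.span ℝ (Set.range v) = Submodule.span ℝ (Set.range u) := by
    refine Submodule.eq_of_le_of_finrank_eq (Submodule.span_mono ?_) ?_
    · rintro _ ⟨k, rfl⟩
      exact ⟨_, rfl⟩
    · rw [finrank_span_eq_card (linearIndependent_consecutive hnn hsupp i), Fintype.card_fin,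
        ← hr, rank_eq_finrank_span_cols]
      rfl
  have hker : Submodule.span ℝ (Set.range v)
      ≤ LinearMap.ker ((LinearMap.proj i).comp A.mulVecLin) := by
    rw [Submodule.span_le]
    rintro _ ⟨k, rfl⟩
    refine hA.mulVec_eq_zero_of_mem_supp hs (hnn _) (h0 _) ?_
    have hi : i ∈ supp (v k) := by
      rw [hv, hsupp, mem_circIdx_add_ofNat_iff i (by omega) (by omega)]
      omega
    exact hi
  exact hker (hspan ▸ Submodule.subset_span ⟨j, rfl⟩)

end CirculantSupport

theorem statement10 (n : ℕ) (hn : 5 ≤ n) (u : Fin n → Fin n → ℝ)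
    (hnn : ∀ j i, 0 ≤ u j i) (hsupp : ∀ j, supp (u j) = circIdx n j) :
    ({A : Matrix (Fin n) (Fin n) ℝ |
        A.IsSymm ∧ Copositive A ∧ ∀ j, u j ⬝ᵥ A.mulVec (u j) = 0} =
      {A : Matrix (Fin n) (Fin n) ℝ | A.PosSemidef ∧ ∀ j, u j ⬝ᵥ A.mulVec (u j) = 0} ∧
      ∃ A : Matrix (Fin n) (Fin n) ℝ,
        A.PosSemidef ∧ (∀ j, u j ⬝ᵥ A.mulVec (u j) = 0) ∧ A.rank = n - 3)
    ↔ (Matrix.of fun i j : Fin n => u j i).rank = 3 := by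
  obtain ⟨m, rfl⟩ : ∃ m, n = m + 5 := ⟨n - 5, by omega⟩
  have hcol : ∀ A : Matrix (Fin (m + 5)) (Fin (m + 5)) ℝ,
      A * (Matrix.of fun i j => u j i) = 0 ↔ ∀ j, A.mulVec (u j) = 0 := fun A =>
    ⟨fun h j => funext fun i => congrFun (congrFun h i) j,
      fun h => Matrix.ext fun i j => congrFun (h j) i⟩
  constructor
  · rintro ⟨-, A, hA, h0, hr⟩
    have hAU : A * (Matrix.of fun i j => u j i) = 0 := (hcol A).2 fun j =>
      (hA.dotProduct_mulVec_zero_iff (u j)).1 (by simpa using h0 j)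
    have hle := rank_add_rank_le_card_of_mul_eq_zero hAU
    rw [Fintype.card_fin] at hle
    have hge : 3 ≤ (Matrix.of fun i j => u j i).rank := by
      rw [rank_eq_finrank_span_cols]
      have h3 := finrank_span_eq_card (linearIndependent_consecutive hnn hsupp 0)
      rw [Fintype.card_fin] at h3
      rw [← h3]
      refine Submodule.finrank_mono (Submodule.span_mono ?_)
      rintro _ ⟨k, rfl⟩
      exact ⟨_, rfl⟩
    omega
  · intro hr
    refine ⟨Set.ext fun A => ⟨?_, ?_⟩, ?_⟩
    · rintro ⟨hs, hA, h0⟩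
      refine ⟨hA.posSemidef_of_mulVec_eq_zero hs (w := ∑ j, u j) (fun i => ?_) ?_, h0⟩
      · rw [Finset.sum_apply]
        refine Finset.sum_pos' (fun j _ => hnn j i) ⟨i, Finset.mem_univ i, ?_⟩
        have hi : i ∈ supp (u i) := by rw [hsupp]; exact mem_circIdx_self i
        exact hi
      · rw [mulVec_sum]
        exact Finset.sum_eq_zero fun j _ => mul_eq_zero_of_copositive hnn hsupp hr hA hs h0 j
    · rintro ⟨hA, h0⟩
      refine ⟨?_, fun x _ => by simpa using hA.dotProduct_mulVec_nonneg x, h0⟩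
      rw [IsSymm, ← conjTranspose_eq_transpose_of_trivial, hA.isHermitian.eq]
    · obtain ⟨A, hA, hAU, hAr⟩ := exists_posSemidef_mul_eq_zero (Matrix.of fun i j => u j i)
      refine ⟨A, hA, fun j => ?_, by rw [hAr, hr]⟩
      rw [(hcol A).1 hAU j, dotProduct_zero]
end

section
/- Let A be a real symmetric n×n matrix, and let I = (1,…,n−1) and I′ = (2,…,n). Suppose the principal submatrices A_I and A_{I′} are positive semidefinite, and that there exist vectors u, v ∈ ℝⁿ with u₁ > 0, v_n > 0, v₁ = u_n = 0, and uᵀAu = vᵀAv = 0. Then there exists a unique real number δ such that A − δ·E₁ₙ is positive semidefinite, where E₁ₙ is the symmetric matrix with ones at positions (1,n) and (n,1) and zeros elsewhere; this δ has the same sign as uᵀAv (i.e., δ > 0 iff uᵀAv > 0, δ = 0 iff uᵀAv = 0, δ < 0 iff uᵀAv < 0); and the vector u + v lies in the kernel of A − δ·E₁ₙ. -/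
open Matrix

/-- The symmetric matrix with ones at the two corner positions `(0, last)` and `(last, 0)`
and zeros elsewhere. -/
def cornerE (n : ℕ) : Matrix (Fin (n + 2)) (Fin (n + 2)) ℝ :=
  Matrix.of fun i j =>
    if (i = 0 ∧ j = Fin.last (n + 1)) ∨ (i = Fin.last (n + 1) ∧ j = 0) then 1 else 0

lemma submatrix_castSucc_mulVec {m : ℕ} (A : Matrix (Fin (m + 1)) (Fin (m + 1)) ℝ)
    (x : Fin (m + 1) → ℝ) (hx : x (Fin.last m) = 0) :
    A.submatrix Fin.castSucc Fin.castSucc *ᵥ (x ∘ Fin.castSucc) = (A *ᵥ x) ∘ Fin.castSucc := by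
  ext i
  simp [mulVec, dotProduct, Fin.sum_univ_castSucc, hx]

lemma submatrix_succ_mulVec {m : ℕ} (A : Matrix (Fin (m + 1)) (Fin (m + 1)) ℝ)
    (x : Fin (m + 1) → ℝ) (hx : x 0 = 0) :
    A.submatrix Fin.succ Fin.succ *ᵥ (x ∘ Fin.succ) = (A *ᵥ x) ∘ Fin.succ := by
  ext i
  simp [mulVec, dotProduct, Fin.sum_univ_succ, hx]

lemma dotProduct_comp_castSucc {m : ℕ} (x y : Fin (m + 1) → ℝ) (hx : x (Fin.last m) = 0) :
    (x ∘ Fin.castSucc) ⬝ᵥ (y ∘ Fin.castSucc) = x ⬝ᵥ y := by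
  simp [dotProduct, Fin.sum_univ_castSucc, hx]

lemma dotProduct_comp_succ {m : ℕ} (x y : Fin (m + 1) → ℝ) (hx : x 0 = 0) :
    (x ∘ Fin.succ) ⬝ᵥ (y ∘ Fin.succ) = x ⬝ᵥ y := by
  simp [dotProduct, Fin.sum_univ_succ, hx]

lemma mulVec_eq_single_last {m : ℕ} {A : Matrix (Fin (m + 1)) (Fin (m + 1)) ℝ}
    (hA : (A.submatrix Fin.castSucc Fin.castSucc).PosSemidef) {x : Fin (m + 1) → ℝ}
    (hx : x (Fin.last m) = 0) (h : x ⬝ᵥ A *ᵥ x = 0) :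
    A *ᵥ x = Pi.single (Fin.last m) ((A *ᵥ x) (Fin.last m)) := by
  have key := (hA.dotProduct_mulVec_zero_iff (x ∘ Fin.castSucc)).1 (by
    rw [star_trivial, submatrix_castSucc_mulVec A x hx, dotProduct_comp_castSucc _ _ hx, h])
  rw [submatrix_castSucc_mulVec A x hx] at key
  ext i
  refine Fin.lastCases ?_ (fun j => ?_) i
  · simp
  · simpa [Pi.single_apply, Fin.castSucc_ne_last] using congrFun key j

lemma mulVec_eq_single_zero {m : ℕ} {A : Matrix (Fin (m + 1)) (Fin (m + 1)) ℝ}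
    (hA : (A.submatrix Fin.succ Fin.succ).PosSemidef) {x : Fin (m + 1) → ℝ}
    (hx : x 0 = 0) (h : x ⬝ᵥ A *ᵥ x = 0) :
    A *ᵥ x = Pi.single 0 ((A *ᵥ x) 0) := by
  have key := (hA.dotProduct_mulVec_zero_iff (x ∘ Fin.succ)).1 (by
    rw [star_trivial, submatrix_succ_mulVec A x hx, dotProduct_comp_succ _ _ hx, h])
  rw [submatrix_succ_mulVec A x hx] at key
  ext i
  refine Fin.cases ?_ (fun j => ?_) i
  · simp
  · simpa [Pi.single_apply, Fin.succ_ne_zero] using congrFun key j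

lemma dotProduct_mulVec_nonneg_of_zero {m : ℕ} {A : Matrix (Fin (m + 1)) (Fin (m + 1)) ℝ}
    (hA : (A.submatrix Fin.succ Fin.succ).PosSemidef) {x : Fin (m + 1) → ℝ} (hx : x 0 = 0) :
    0 ≤ x ⬝ᵥ A *ᵥ x := by
  have h := hA.dotProduct_mulVec_nonneg (x ∘ Fin.succ)
  rwa [star_trivial, submatrix_succ_mulVec A x hx, dotProduct_comp_succ _ _ hx] at h

lemma cornerE_isSymm (n : ℕ) : (cornerE n).IsSymm := by
  ext i j
  simp only [cornerE, transpose_apply, of_apply]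
  congr 1
  grind

lemma cornerE_mulVec (n : ℕ) (x : Fin (n + 2) → ℝ) :
    cornerE n *ᵥ x = Pi.single 0 (x (Fin.last (n + 1))) + Pi.single (Fin.last (n + 1)) (x 0) := by
  have h0 : (0 : Fin (n + 2)) ≠ Fin.last (n + 1) := (Fin.last_pos).ne
  ext i
  by_cases hi : i = 0
  · subst hi
    simp [mulVec, dotProduct, cornerE, h0]
  · by_cases hl : i = Fin.last (n + 1)
    · subst hl
      simp [mulVec, dotProduct, cornerE, h0.symm]
    · simp [mulVec, dotProduct, cornerE, hi, hl]

theorem statement15 (n : ℕ) (A : Matrix (Fin (n + 2)) (Fin (n + 2)) ℝ) (hA : A.IsSymm)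
    (hI : (A.submatrix Fin.castSucc Fin.castSucc).PosSemidef)
    (hI' : (A.submatrix Fin.succ Fin.succ).PosSemidef)
    (u v : Fin (n + 2) → ℝ)
    (hu1 : 0 < u 0) (hvn : 0 < v (Fin.last (n + 1)))
    (hv1 : v 0 = 0) (hun : u (Fin.last (n + 1)) = 0)
    (huA : u ⬝ᵥ A.mulVec u = 0) (hvA : v ⬝ᵥ A.mulVec v = 0) :
    ∃ δ : ℝ,
      (A - δ • cornerE n).PosSemidef ∧
      (∀ δ' : ℝ, (A - δ' • cornerE n).PosSemidef → δ' = δ) ∧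
      (0 < δ ↔ 0 < u ⬝ᵥ A.mulVec v) ∧
      (δ = 0 ↔ u ⬝ᵥ A.mulVec v = 0) ∧
      (δ < 0 ↔ u ⬝ᵥ A.mulVec v < 0) ∧
      (A - δ • cornerE n).mulVec (u + v) = 0 := by
  have hsymm : ∀ {M : Matrix (Fin (n + 2)) (Fin (n + 2)) ℝ}, M.IsSymm →
      ∀ x y : Fin (n + 2) → ℝ, x ⬝ᵥ M *ᵥ y = y ⬝ᵥ M *ᵥ x := fun {M} hM x y => by
    rw [dotProduct_mulVec, dotProduct_comm, ← mulVec_transpose, hM.eq]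
  have hAu := mulVec_eq_single_last hI hun huA
  have hAv := mulVec_eq_single_zero hI' hv1 hvA
  have huv : u ⬝ᵥ A *ᵥ v = u 0 * (A *ᵥ v) 0 := by
    rw [hAv]; simp
  have hvu : u ⬝ᵥ A *ᵥ v = v (Fin.last (n + 1)) * (A *ᵥ u) (Fin.last (n + 1)) := by
    rw [hsymm hA, hAu]; simp
  have hpos : 0 < u 0 * v (Fin.last (n + 1)) := mul_pos hu1 hvn
  set c := u ⬝ᵥ A *ᵥ v
  obtain ⟨δ, hδ⟩ : ∃ δ : ℝ, c = δ * (u 0 * v (Fin.last (n + 1))) :=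
    ⟨c / (u 0 * v (Fin.last (n + 1))), (div_mul_cancel₀ _ hpos.ne').symm⟩
  have hBu : (A - δ • cornerE n) *ᵥ u = 0 := by
    have : (A *ᵥ u) (Fin.last (n + 1)) = δ * u 0 :=
      mul_left_cancel₀ hvn.ne' (by linarith)
    rw [sub_mulVec, smul_mulVec, cornerE_mulVec, hAu, this, hun]
    simp [← Pi.single_smul]
  have hBv : (A - δ • cornerE n) *ᵥ v = 0 := by
    have : (A *ᵥ v) 0 = δ * v (Fin.last (n + 1)) :=
      mul_left_cancel₀ hu1.ne' (by linarith)
    rw [sub_mulVec, smul_mulVec, cornerE_mulVec, hAv, this, hv1]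
    simp [← Pi.single_smul]
  have hBsymm : (A - δ • cornerE n).IsSymm := hA.sub ((cornerE_isSymm n).smul δ)
  refine ⟨δ, .of_dotProduct_mulVec_nonneg
      ((conjTranspose_eq_transpose_of_trivial _).trans hBsymm) fun x => ?_,
    fun δ' h => ?_, ?_, ?_, ?_, by rw [mulVec_add, hBu, hBv, add_zero]⟩
  · rw [star_trivial]
    obtain ⟨y, t, hy, rfl⟩ : ∃ (y : Fin (n + 2) → ℝ) (t : ℝ), y 0 = 0 ∧ x = y + t • u :=
      ⟨x - (x 0 / u 0) • u, x 0 / u 0, by simp [hu1.ne'], by simp⟩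
    have hBy : (y + t • u) ⬝ᵥ (A - δ • cornerE n) *ᵥ (y + t • u) = y ⬝ᵥ A *ᵥ y := by
      rw [mulVec_add, mulVec_smul, hBu, smul_zero, add_zero, hsymm hBsymm, mulVec_add,
        mulVec_smul, hBu, smul_zero, add_zero, sub_mulVec, smul_mulVec, cornerE_mulVec]
      simp [hy, dotProduct_sub]
    rw [hBy]
    exact dotProduct_mulVec_nonneg_of_zero hI' hy
  · have hform : ∀ s : ℝ, (u + s • v) ⬝ᵥ (A - δ' • cornerE n) *ᵥ (u + s • v)
        = 2 * s * ((δ - δ') * (u 0 * v (Fin.last (n + 1)))) := fun s => by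
      have hB : A - δ' • cornerE n = (A - δ • cornerE n) + (δ - δ') • cornerE n := by
        rw [sub_smul]; abel
      rw [hB, add_mulVec, mulVec_add, mulVec_smul, hBu, hBv, smul_mulVec, cornerE_mulVec]
      simp [hun, hv1]
      ring
    have h1 := h.dotProduct_mulVec_nonneg (u + (1 : ℝ) • v)
    have h2 := h.dotProduct_mulVec_nonneg (u + (-1 : ℝ) • v)
    rw [star_trivial, hform] at h1 h2
    have h3 : (δ - δ') * (u 0 * v (Fin.last (n + 1))) = 0 := by linarith
    linarith [(mul_eq_zero.1 h3).resolve_right hpos.ne']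
  · rw [hδ, mul_pos_iff_of_pos_right hpos]
  · rw [hδ, mul_eq_zero, or_iff_left hpos.ne']
  · rw [hδ, ← neg_pos, ← neg_pos (a := _ * _), ← neg_mul, mul_pos_iff_of_pos_right hpos]
end

section
/- Let u¹,…,uⁿ ∈ ℝⁿ be nonzero vectors such that no two of them are proportional and the dimension of their linear span is at least n−1. Then the rank-one matrices u¹(u¹)ᵀ, …, uⁿ(uⁿ)ᵀ are linearly independent in the space of real symmetric n×n matrices. -/
open Matrix

/-- If the span of a finite family is at most one dimension short of the size of the family,
any two linear relations among its members are proportional. -/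
theorem mul_eq_mul_of_linear_relations {K V ι : Type*} [Field K] [AddCommGroup V] [Module K V]
    [Fintype ι] (u : ι → V)
    (hdim : Fintype.card ι - 1 ≤ Module.finrank K (Submodule.span K (Set.range u)))
    {c d : ι → K} (hc : ∑ i, c i • u i = 0) (hd : ∑ i, d i • u i = 0) (j k : ι) :
    c j * d k = c k * d j := by
  have hker : Module.finrank K (LinearMap.ker (Fintype.linearCombination K u)) ≤ 1 := by
    have h := LinearMap.finrank_range_add_finrank_ker (Fintype.linearCombination K u)
    rw [Fintype.range_linearCombination, Module.finrank_fintype_fun_eq_card] at h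
    omega
  obtain ⟨v, hv⟩ := finrank_le_one_iff.mp hker
  obtain ⟨a, ha⟩ := hv ⟨c, by simpa [Fintype.linearCombination_apply] using hc⟩
  obtain ⟨b, hb⟩ := hv ⟨d, by simpa [Fintype.linearCombination_apply] using hd⟩
  have hc' : c = a • (v : ι → K) := (congrArg Subtype.val ha).symm
  have hd' : d = b • (v : ι → K) := (congrArg Subtype.val hb).symm
  simp only [hc', hd', Pi.smul_apply, smul_eq_mul]
  ring

theorem statement16 (n : ℕ) (u : Fin n → Fin n → ℝ)
    (hnz : ∀ i, u i ≠ 0)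
    (hprop : ∀ i j, i ≠ j → ∀ c : ℝ, u i ≠ c • u j)
    (hdim : n - 1 ≤ Module.finrank ℝ (Submodule.span ℝ (Set.range u))) :
    LinearIndependent ℝ (fun i => Matrix.vecMulVec (u i) (u i)) := by
  rw [Fintype.linearIndependent_iff]
  intro a ha k
  by_contra hk
  have hrel (y : Fin n → ℝ) : ∑ i, (a i * (u i ⬝ᵥ y)) • u i = 0 := by
    have h := congrArg (fun M : Matrix (Fin n) (Fin n) ℝ => M *ᵥ y) ha
    simpa [Matrix.sum_mulVec, Matrix.smul_mulVec, Matrix.vecMulVec_mulVec, mul_smul] using h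
  have hkk : u k ⬝ᵥ u k ≠ 0 := fun h => hnz k (dotProduct_self_eq_zero.mp h)
  obtain ⟨j, hjk, hj⟩ : ∃ j, j ≠ k ∧ a j ≠ 0 := by
    by_contra! h
    have hsum := hrel (u k)
    rw [Finset.sum_eq_single k (fun i _ hi => by simp [h i hi]) (by simp)] at hsum
    exact smul_ne_zero (mul_ne_zero hk hkk) (hnz k) hsum
  refine hprop j k hjk ((u j ⬝ᵥ u k) / (u k ⬝ᵥ u k)) (dotProduct_eq _ _ fun y => ?_)
  have h := mul_eq_mul_of_linear_relations u (by simpa using hdim) (hrel y) (hrel (u k)) j k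
  rw [smul_dotProduct, smul_eq_mul, div_mul_eq_mul_div, eq_div_iff hkk]
  apply mul_left_cancel₀ (mul_ne_zero hj hk)
  linear_combination h
end

section
/- Let M be a real n×n matrix of rank n−1, let u ∈ ℝⁿ be a nonzero vector spanning the left kernel of M (i.e., uᵀM = 0), and let v ∈ ℝⁿ be a nonzero vector spanning the right kernel of M (i.e., Mv = 0). Then there exists a nonzero real number c such that the adjugate matrix of M equals c·vuᵀ. -/
open Matrix

namespace Matrix

variable {K m : Type*} [Field K] [Fintype m]

theorem exists_eq_smul_of_mulVec_eq_zero {M : Matrix m m K}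
    (hrank : M.rank = Fintype.card m - 1) {v : m → K} (hv : v ≠ 0) (hvk : M *ᵥ v = 0)
    {x : m → K} (hx : M *ᵥ x = 0) : ∃ t : K, x = t • v := by
  have hne : Nonempty m := not_isEmpty_iff.mp fun h => hv (Subsingleton.elim _ _)
  have hker : Module.finrank K (LinearMap.ker M.mulVecLin) = 1 := by
    have h := LinearMap.finrank_range_add_finrank_ker M.mulVecLin
    rw [Module.finrank_fintype_fun_eq_card] at h
    have hr : Module.finrank K (LinearMap.range M.mulVecLin) = Fintype.card m - 1 := hrank
    have := Fintype.card_pos (α := m)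
    omega
  obtain ⟨t, ht⟩ := exists_smul_eq_of_finrank_eq_one hker
    (x := ⟨v, hvk⟩) (fun h => hv (congrArg Subtype.val h)) ⟨x, hx⟩
  exact ⟨t, (congrArg Subtype.val ht).symm⟩

theorem exists_eq_smul_of_vecMul_eq_zero {M : Matrix m m K}
    (hrank : M.rank = Fintype.card m - 1) {u : m → K} (hu : u ≠ 0) (huk : u ᵥ* M = 0)
    {x : m → K} (hx : x ᵥ* M = 0) : ∃ t : K, x = t • u :=
  exists_eq_smul_of_mulVec_eq_zero (M := Mᵀ) (by rw [rank_transpose, hrank]) hu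
    (by rw [mulVec_transpose, huk]) (by rw [mulVec_transpose, hx])

variable [DecidableEq m]

theorem adjugate_apply_ne_zero_of_rank_eq {M : Matrix m m K}
    (hrank : M.rank = Fintype.card m - 1) {u v : m → K} (huk : u ᵥ* M = 0) (hvk : M *ᵥ v = 0)
    {i j : m} (hi : v i ≠ 0) (hj : u j ≠ 0) : M.adjugate i j ≠ 0 := by
  rw [adjugate_apply]
  intro hdet
  obtain ⟨x, hx0, hx⟩ := exists_mulVec_eq_zero_iff.mpr hdet
  have hxi : x i = 0 := by simpa [mulVec] using congrFun hx j
  have hrow : ∀ k, k ≠ j → (M *ᵥ x) k = 0 := fun k hk => by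
    simpa [mulVec, updateRow_ne hk] using congrFun hx k
  have hMx : M *ᵥ x = 0 := by
    have h : u ⬝ᵥ M *ᵥ x = 0 := by rw [dotProduct_mulVec, huk, zero_dotProduct]
    rw [dotProduct, Finset.sum_eq_single j (fun k _ hk => by rw [hrow k hk, mul_zero])
      (fun hk => absurd (Finset.mem_univ j) hk)] at h
    funext k
    by_cases hk : k = j
    · rw [hk]
      exact (mul_eq_zero.mp h).resolve_left hj
    · exact hrow k hk
  obtain ⟨t, rfl⟩ := exists_eq_smul_of_mulVec_eq_zero hrank
    (fun h => hi (congrFun h i)) hvk hMx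
  have ht : t = 0 := (mul_eq_zero.mp hxi).resolve_right hi
  exact hx0 (by rw [ht, zero_smul])

theorem exists_adjugate_eq_smul_vecMulVec {M : Matrix m m K}
    (hrank : M.rank = Fintype.card m - 1) {u v : m → K}
    (hu : u ≠ 0) (huk : u ᵥ* M = 0) (hv : v ≠ 0) (hvk : M *ᵥ v = 0) :
    ∃ c : K, c ≠ 0 ∧ M.adjugate = c • vecMulVec v u := by
  obtain ⟨i, hi⟩ := Function.ne_iff.mp hv
  obtain ⟨j, hj⟩ := Function.ne_iff.mp hu
  have hdet : M.det = 0 := exists_mulVec_eq_zero_iff.mp ⟨v, hv, hvk⟩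
  have hcol : ∀ l, ∃ t : K, M.adjugate.col l = t • v := fun l =>
    exists_eq_smul_of_mulVec_eq_zero hrank hv hvk <| by
      funext k
      have h := congrFun (congrFun (mul_adjugate M) k) l
      rw [hdet, zero_smul] at h
      exact h
  choose w hw using hcol
  have hw' : ∀ k l, M.adjugate k l = w l * v k := fun k l => congrFun (hw l) k
  obtain ⟨d, hd⟩ := exists_eq_smul_of_vecMul_eq_zero hrank hu huk (x := M.adjugate.row i) <| by
    funext l
    have h := congrFun (congrFun (adjugate_mul M) i) l
    rw [hdet, zero_smul] at h
    exact h
  have hd' : ∀ l, M.adjugate i l = d * u l := fun l => congrFun hd l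
  refine ⟨d / v i, div_ne_zero ?_ hi, ?_⟩
  · rintro rfl
    exact adjugate_apply_ne_zero_of_rank_eq hrank huk hvk hi hj (by rw [hd', zero_mul])
  · ext k l
    have hwl : w l = d * u l / v i := by
      rw [eq_div_iff hi, ← hw', hd']
    rw [hw', hwl, smul_apply, vecMulVec_apply, smul_eq_mul]
    ring

end Matrix

theorem statement17 (n : ℕ) (M : Matrix (Fin n) (Fin n) ℝ) (hrank : M.rank = n - 1)
    (u v : Fin n → ℝ)
    (hu : u ≠ 0) (huk : Matrix.vecMul u M = 0)
    (hv : v ≠ 0) (hvk : M.mulVec v = 0) :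
    ∃ c : ℝ, c ≠ 0 ∧ M.adjugate = c • Matrix.vecMulVec v u := by
  exact exists_adjugate_eq_smul_vecMulVec (by rw [hrank, Fintype.card_fin]) hu huk hv hvk
end

section
/- Let T be a singular real symmetric positive semidefinite N×N Toeplitz matrix of rank k ≥ 1 which possesses an entrywise nonnegative nonzero kernel vector u. Set m = ⌊k/2⌋. Then there exist distinct angles ζ₀ = π and ζ₁,…,ζ_m ∈ (0,π) and positive real numbers λ₀,…,λ_m such that T = Σ_{j=0}^{m} λ_j T(ζ_j) if k is odd, and T = Σ_{j=1}^{m} λ_j T(ζ_j) if k is even, where T(ζ) denotes the symmetric N×N Toeplitz matrix with entries T(ζ)_{st} = cos((s−t)ζ). Moreover, if p(x) = Σ_{l=1}^{N} u_l x^{l−1} is the polynomial whose coefficients are the entries of u, then e^{iζ_j} and e^{−iζ_j} are roots of p for j = 1,…,m, and if k is odd then −1 is also a root of p. -/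
open Matrix

/-- The symmetric `N × N` Toeplitz matrix with entries `cos((s-t)·ζ)`. -/
noncomputable def cosToeplitz (N : ℕ) (ζ : ℝ) : Matrix (Fin N) (Fin N) ℝ :=
  Matrix.of fun s t : Fin N => Real.cos ((((s : ℕ) : ℝ) - ((t : ℕ) : ℝ)) * ζ)

theorem exists_linearIsometry_comp_eq {V E : Type*} [AddCommGroup V] [Module ℝ V]
    [NormedAddCommGroup E] [InnerProductSpace ℝ E] [FiniteDimensional ℝ E]
    (F G : V →ₗ[ℝ] E) (h : ∀ a, ‖F a‖ = ‖G a‖) :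
    ∃ U : E →ₗᵢ[ℝ] E, ∀ a, U (F a) = G a := by
  obtain ⟨g, hg⟩ := F.rangeRestrict.exists_rightInverse_of_surjective F.range_rangeRestrict
  have hg' : ∀ x, F (g x) = x := fun x => congrArg Subtype.val (LinearMap.congr_fun hg x)
  let L : LinearMap.range F →ₗᵢ[ℝ] E :=
    ⟨G ∘ₗ g, fun x => by
      rw [LinearMap.comp_apply, ← h, hg']; rfl⟩
  refine ⟨L.extend, fun a => ?_⟩
  have h1 := L.extend_apply ⟨F a, a, rfl⟩
  rw [h1]
  change G (g _) = G a
  rw [← sub_eq_zero, ← map_sub, ← norm_eq_zero, ← h, map_sub, hg', sub_self, norm_zero]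

theorem pow_add_pow_apply_of_add_apply {E : Type*} [AddCommGroup E] [Module ℝ E]
    (U V : Module.End ℝ E) (hUV : U * V = 1) (hVU : V * U = 1) (b : E) (θ : ℝ)
    (hb : (U + V) b = (2 * Real.cos θ) • b) (n : ℕ) :
    (U ^ n + V ^ n) b = (2 * Real.cos (n * θ)) • b := by
  induction n using Nat.twoStepInduction with
  | zero => simp [two_smul]
  | one => simpa using hb
  | more n h0 h1 =>
    have key : U ^ (n + 2) + V ^ (n + 2)
        = (U + V) * (U ^ (n + 1) + V ^ (n + 1)) - (U ^ n + V ^ n) := by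
      have e1 : U * V ^ (n + 1) = V ^ n := by rw [pow_succ', ← mul_assoc, hUV, one_mul]
      have e2 : V * U ^ (n + 1) = U ^ n := by rw [pow_succ', ← mul_assoc, hVU, one_mul]
      rw [add_mul, mul_add, mul_add, e1, e2, ← pow_succ', ← pow_succ']
      abel
    rw [key, LinearMap.sub_apply, Module.End.mul_apply, h1, map_smul, hb, h0, smul_smul, ← sub_smul]
    congr 1
    have e3 := Real.cos_add (((n + 1 : ℕ) : ℝ) * θ) θ
    have e4 := Real.cos_sub (((n + 1 : ℕ) : ℝ) * θ) θ
    rw [show ((n + 2 : ℕ) : ℝ) * θ = ((n + 1 : ℕ) : ℝ) * θ + θ by push_cast; ring]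
    rw [show ((n + 1 : ℕ) : ℝ) * θ - θ = n * θ by push_cast; ring] at e4
    rw [e3, e4]; ring

theorem exists_inner_pow_eq_sum_cos {E : Type*} [NormedAddCommGroup E] [InnerProductSpace ℝ E]
    [FiniteDimensional ℝ E] (U : E →ₗᵢ[ℝ] E) (v : E) :
    ∃ (w θ : Fin (Module.finrank ℝ E) → ℝ), (∀ i, 0 ≤ w i) ∧
      (∀ i, θ i ∈ Set.Icc 0 Real.pi) ∧
      ∀ n : ℕ, inner ℝ ((U.toLinearMap ^ n) v) v = ∑ i, w i * Real.cos (n * θ i) := by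
  set A : Module.End ℝ E := U.toLinearMap with hA
  set B : Module.End ℝ E := LinearMap.adjoint A with hB
  have hBA : B * A = 1 := by
    ext x
    refine ext_inner_right ℝ fun y => ?_
    rw [Module.End.mul_apply, hB, LinearMap.adjoint_inner_left]
    exact U.inner_map_map x y
  have hAB : A * B = 1 := mul_eq_one_comm.mp hBA
  have hsymm : (A + B).IsSymmetric := by
    intro x y
    rw [LinearMap.add_apply, LinearMap.add_apply, inner_add_left, inner_add_right, hB,
      LinearMap.adjoint_inner_left, LinearMap.adjoint_inner_right, add_comm]
  set b := hsymm.eigenvectorBasis rfl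
  set a := hsymm.eigenvalues rfl
  have hab : ∀ i, (A + B) (b i) = a i • b i := fun i => hsymm.apply_eigenvectorBasis rfl i
  have hbd : ∀ i, |a i| ≤ 2 := by
    intro i
    have h1 : inner ℝ (b i) ((A + B) (b i)) = a i := by
      rw [hab, inner_smul_right, real_inner_self_eq_norm_sq, b.norm_eq_one]; simp
    have h2 : inner ℝ (b i) ((A + B) (b i)) = 2 * inner ℝ (b i) (A (b i)) := by
      rw [LinearMap.add_apply, inner_add_right, hB, LinearMap.adjoint_inner_right,
        real_inner_comm]; ring
    have h3 := abs_real_inner_le_norm (b i) (A (b i))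
    have h4 : ‖A (b i)‖ = ‖b i‖ := U.norm_map _
    rw [h4, b.norm_eq_one] at h3
    rw [← h1, h2, abs_mul, abs_two]; linarith
  have hbd' : ∀ i, -1 ≤ a i / 2 ∧ a i / 2 ≤ 1 := fun i => by
    have := abs_le.mp (hbd i); constructor <;> linarith
  refine ⟨fun i => inner ℝ v (b i) ^ 2, fun i => Real.arccos (a i / 2), fun i => sq_nonneg _,
    fun i => ⟨Real.arccos_nonneg _, Real.arccos_le_pi _⟩, fun n => ?_⟩
  have key : ∀ i, (A ^ n + B ^ n) (b i) = (2 * Real.cos (n * Real.arccos (a i / 2))) • b i := by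
    intro i
    apply pow_add_pow_apply_of_add_apply A B hAB hBA
    rw [hab, Real.cos_arccos (hbd' i).1 (hbd' i).2]; congr 1; ring
  have hadj : LinearMap.adjoint (A ^ n) = B ^ n := by
    rw [← LinearMap.star_eq_adjoint, star_pow, LinearMap.star_eq_adjoint]
  have h5 : ∀ x y, inner ℝ ((A ^ n + B ^ n) x) y = inner ℝ x ((A ^ n + B ^ n) y) := by
    intro x y
    rw [LinearMap.add_apply, LinearMap.add_apply, inner_add_left, inner_add_right, ← hadj,
      LinearMap.adjoint_inner_left, LinearMap.adjoint_inner_right, add_comm]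
  have h6 : inner ℝ ((A ^ n + B ^ n) v) v = 2 * inner ℝ ((A ^ n) v) v := by
    rw [LinearMap.add_apply, inner_add_left, ← hadj, LinearMap.adjoint_inner_left,
      real_inner_comm v]; ring
  have h7 := b.sum_inner_mul_inner ((A ^ n + B ^ n) v) v
  have h8 : ∑ i, inner ℝ ((A ^ n + B ^ n) v) (b i) * inner ℝ (b i) v =
      2 * ∑ i, inner ℝ v (b i) ^ 2 * Real.cos (n * Real.arccos (a i / 2)) := by
    rw [Finset.mul_sum]
    refine Finset.sum_congr rfl fun i _ => ?_
    rw [h5, key, inner_smul_right, real_inner_comm v]; ring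
  linarith

theorem exists_gram_eq_of_posSemidef {N : ℕ} {T : Matrix (Fin N) (Fin N) ℝ} (hT : T.PosSemidef) :
    ∃ v : Fin N → EuclideanSpace ℝ (Fin N), ∀ s t, T s t = inner ℝ (v s) (v t) := by
  open scoped MatrixOrder ComplexOrder in
  obtain ⟨X, hX⟩ : ∃ X : Matrix (Fin N) (Fin N) ℝ, T = Xᴴ * X := by
    obtain ⟨X, hX, -, h⟩ :=
      CFC.exists_sqrt_of_isSelfAdjoint_of_quasispectrumRestricts (a := T) hT.isHermitian
        (QuasispectrumRestricts.nnreal_of_nonneg hT.nonneg)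
    exact ⟨X, by rw [← h, ← Matrix.star_eq_conjTranspose, hX.star_eq]⟩
  refine ⟨fun s => WithLp.toLp 2 fun j => X j s, fun s t => ?_⟩
  simp [hX, Matrix.mul_apply, PiLp.inner_apply, mul_comm]

theorem exists_linearIsometry_pow_apply_eq {E : Type*} [NormedAddCommGroup E]
    [InnerProductSpace ℝ E] [FiniteDimensional ℝ E] {n : ℕ} (v : Fin (n + 1) → E)
    (h : ∀ i j : Fin n, inner ℝ (v i.castSucc) (v j.castSucc) = inner ℝ (v i.succ) (v j.succ)) :
    ∃ U : E →ₗᵢ[ℝ] E, ∀ i : Fin (n + 1), (U.toLinearMap ^ (i : ℕ)) (v 0) = v i := by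
  obtain ⟨U, hU⟩ := exists_linearIsometry_comp_eq
    (Fintype.linearCombination ℝ fun i : Fin n => v i.castSucc)
    (Fintype.linearCombination ℝ fun i : Fin n => v i.succ) (fun a => by
      rw [← sq_eq_sq₀ (norm_nonneg _) (norm_nonneg _), ← real_inner_self_eq_norm_sq,
        ← real_inner_self_eq_norm_sq]
      simp only [Fintype.linearCombination_apply, sum_inner, inner_sum, inner_smul_left,
        inner_smul_right, h])
  refine ⟨U, fun i => ?_⟩
  induction i using Fin.induction with
  | zero => simp
  | succ i ih =>
    rw [Fin.val_succ, pow_succ', Module.End.mul_apply, ← Fin.val_castSucc, ih]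
    classical
    simpa using hU (Pi.single i 1)

theorem exists_eq_sum_smul_cosToeplitz {N : ℕ} {T : Matrix (Fin N) (Fin N) ℝ} (hT : T.PosSemidef)
    (hToe : ∀ s t s' t' : Fin N, (s : ℤ) - (t : ℤ) = (s' : ℤ) - (t' : ℤ) → T s t = T s' t') :
    ∃ (S : Finset ℝ) (c : ℝ → ℝ), (∀ θ ∈ S, θ ∈ Set.Icc 0 Real.pi) ∧ (∀ θ ∈ S, 0 < c θ) ∧
      T = ∑ θ ∈ S, c θ • cosToeplitz N θ := by
  classical
  rcases N with _ | n
  · exact ⟨∅, 0, by simp, by simp, Subsingleton.elim _ _⟩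
  obtain ⟨v, hv⟩ := exists_gram_eq_of_posSemidef hT
  obtain ⟨U, hU⟩ := exists_linearIsometry_pow_apply_eq v fun i j => by
    rw [← hv, ← hv]; apply hToe; simp
  obtain ⟨w, θ, hw, hθ, hsum⟩ := exists_inner_pow_eq_sum_cos U (v 0)
  have hle : ∀ s t : Fin (n + 1), t ≤ s →
      T s t = ∑ i, w i * Real.cos ((((s : ℕ) : ℝ) - ((t : ℕ) : ℝ)) * θ i) := by
    intro s t hst
    have h1 : T s t = T ⟨s - t, by omega⟩ 0 := hToe _ _ _ _ (by
      rw [Fin.le_def] at hst; simp; omega)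
    rw [h1, hv, ← hU, hsum]
    simp only [Nat.cast_sub (Fin.le_def.mp hst)]
  have hall : ∀ s t : Fin (n + 1),
      T s t = ∑ i, w i * Real.cos ((((s : ℕ) : ℝ) - ((t : ℕ) : ℝ)) * θ i) := by
    intro s t
    rcases le_total t s with h | h
    · exact hle s t h
    · have h1 : T s t = T t s := by simpa using hT.isHermitian.apply t s
      rw [h1, hle t s h]
      refine Finset.sum_congr rfl fun i _ => ?_
      rw [← Real.cos_neg]; congr 2; ring
  set I := Finset.univ.filter fun i => w i ≠ 0
  refine ⟨I.image θ, fun x => ∑ i ∈ I with θ i = x, w i, ?_, ?_, ?_⟩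
  · intro x hx
    obtain ⟨i, -, rfl⟩ := Finset.mem_image.mp hx
    exact hθ i
  · intro x hx
    obtain ⟨i, hi, rfl⟩ := Finset.mem_image.mp hx
    refine Finset.sum_pos (fun j hj => ?_) ⟨i, by simp [hi]⟩
    exact (hw j).lt_of_ne' (Finset.mem_filter.mp (Finset.mem_filter.mp hj).1).2
  · ext s t
    rw [hall, Matrix.sum_apply]
    simp only [Matrix.smul_apply, cosToeplitz, Matrix.of_apply, smul_eq_mul, Finset.sum_mul]
    rw [← Finset.sum_filter_of_ne (p := fun i => w i ≠ 0) fun i _ h => left_ne_zero_of_mul h,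
      ← Finset.sum_fiberwise_of_maps_to (g := θ) (t := I.image θ)
        fun i hi => Finset.mem_image_of_mem θ hi]
    refine Finset.sum_congr rfl fun x _ => Finset.sum_congr rfl fun i hi => ?_
    rw [(Finset.mem_filter.mp hi).2]

open Polynomial in
theorem ofFn_toFn_of_degree_lt {N : ℕ} {p : ℝ[X]} (hp : p.degree < N) :
    ofFn N (toFn N p) = p := by
  by_cases h : p = 0
  · simp [h]
  · exact ofFn_comp_toFn_eq_id_of_natDegree_lt ((natDegree_lt_iff_degree_lt h).mpr hp)

open Polynomial in
theorem finrank_of_mem_iff_dvd_ofFn {N : ℕ} {Q : ℝ[X]} (hQ : Q.Monic) (hN : Q.natDegree ≤ N)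
    (K : Submodule ℝ (Fin N → ℝ)) (hK : ∀ x, x ∈ K ↔ Q ∣ ofFn N x) :
    Module.finrank ℝ K = N - Q.natDegree := by
  let M : (Fin (N - Q.natDegree) → ℝ) →ₗ[ℝ] (Fin N → ℝ) :=
    toFn N ∘ₗ LinearMap.mulLeft ℝ Q ∘ₗ ofFn (N - Q.natDegree)
  have hdeg : ∀ q : ℝ[X], (Q * q).degree < N ↔ q.degree < ((N - Q.natDegree : ℕ) : WithBot ℕ) := by
    intro q
    by_cases hq : q = 0
    · simp [hq]
    · rw [← natDegree_lt_iff_degree_lt hq,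
        ← natDegree_lt_iff_degree_lt (mul_ne_zero hQ.ne_zero hq), hQ.natDegree_mul' hq]
      omega
  have hofM : ∀ a, ofFn N (M a) = Q * ofFn (N - Q.natDegree) a := fun a =>
    ofFn_toFn_of_degree_lt ((hdeg _).mpr (ofFn_degree_lt a))
  have hinj : Function.Injective M := by
    intro a b hab
    have h := congrArg (ofFn N) hab
    rw [hofM, hofM] at h
    exact injective_ofFn _ (mul_left_cancel₀ hQ.ne_zero h)
  have hrange : LinearMap.range M = K := by
    ext x
    rw [hK]
    constructor
    · rintro ⟨a, rfl⟩
      exact ⟨_, hofM a⟩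
    · rintro ⟨q, hq⟩
      refine ⟨toFn _ q, injective_ofFn N ?_⟩
      rw [hofM, ofFn_toFn_of_degree_lt ((hdeg q).mp (hq ▸ ofFn_degree_lt x)), hq]
  rw [← hrange, LinearMap.finrank_range_of_inj hinj, Module.finrank_fin_fun]

/-- The minimal polynomial of `exp (i θ)` over `ℝ`, for `θ ∈ (0, π]`. -/
noncomputable def nodePoly (θ : ℝ) : Polynomial ℝ :=
  if θ = Real.pi then Polynomial.X + Polynomial.C 1
  else Polynomial.X ^ 2 - Polynomial.C (2 * Real.cos θ) * Polynomial.X + Polynomial.C 1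

open Polynomial in
theorem natDegree_nodePoly (θ : ℝ) : (nodePoly θ).natDegree = if θ = Real.pi then 1 else 2 := by
  unfold nodePoly
  split_ifs <;> compute_degree!

open Polynomial in
theorem monic_nodePoly (θ : ℝ) : (nodePoly θ).Monic := by
  unfold nodePoly
  split_ifs <;> monicity!

open Polynomial in
theorem nodePoly_dvd_iff {θ : ℝ} (hθ : θ ∈ Set.Ioc 0 Real.pi) (p : ℝ[X]) :
    nodePoly θ ∣ p ↔ aeval (Complex.exp (θ * Complex.I)) p = 0 := by
  unfold nodePoly
  split_ifs with h
  · subst h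
    rw [Complex.exp_pi_mul_I, show (X + C 1 : ℝ[X]) = X - C (-1) by simp, dvd_iff_isRoot,
      IsRoot.def, show (-1 : ℂ) = algebraMap ℝ ℂ (-1) by simp, aeval_algebraMap_apply]
    simp [coe_aeval_eq_eval]
  · constructor
    · rintro ⟨q, rfl⟩
      rw [map_mul]
      convert zero_mul _
      have h1 : Complex.exp (θ * Complex.I) ≠ 0 := Complex.exp_ne_zero _
      have h2 : (2 * (Real.cos θ : ℂ)) =
          Complex.exp (θ * Complex.I) + (Complex.exp (θ * Complex.I))⁻¹ := by
        rw [Complex.ofReal_cos, Complex.two_cos, ← Complex.exp_neg, neg_mul]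
      simp only [map_add, map_sub, map_mul, map_pow, aeval_X, aeval_C, Complex.coe_algebraMap,
        Complex.ofReal_one, Complex.ofReal_ofNat, h2]
      field_simp
      ring
    · intro h0
      have hsin := Real.sin_pos_of_pos_of_lt_pi hθ.1 (lt_of_le_of_ne hθ.2 h)
      have := quadratic_dvd_of_aeval_eq_zero_im_ne_zero p h0
        (by rw [Complex.exp_ofReal_mul_I_im]; exact hsin.ne')
      simpa [Complex.exp_ofReal_mul_I_re, Complex.norm_exp_ofReal_mul_I] using this

open Polynomial in
theorem isCoprime_nodePoly {θ φ : ℝ} (hθ : θ ∈ Set.Ioc 0 Real.pi) (hφ : φ ∈ Set.Ioc 0 Real.pi)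
    (hne : θ ≠ φ) : IsCoprime (nodePoly θ) (nodePoly φ) := by
  have hcos : Real.cos θ - Real.cos φ ≠ 0 := fun h =>
    hne (Real.injOn_cos ⟨hθ.1.le, hθ.2⟩ ⟨hφ.1.le, hφ.2⟩ (sub_eq_zero.mp h))
  have hlin : ∀ ψ ≠ Real.pi, ψ ∈ Set.Ioc 0 Real.pi →
      IsCoprime (X + C 1 : ℝ[X]) (X ^ 2 - C (2 * Real.cos ψ) * X + C 1) := by
    intro ψ hψ hψ'
    have hc : 2 + 2 * Real.cos ψ ≠ 0 := fun h => by
      refine hψ (Real.injOn_cos ⟨hψ'.1.le, hψ'.2⟩ ⟨Real.pi_pos.le, le_rfl⟩ ?_)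
      rw [Real.cos_pi]; linarith
    refine ⟨-C (2 + 2 * Real.cos ψ)⁻¹ * (X - C (1 + 2 * Real.cos ψ)), C (2 + 2 * Real.cos ψ)⁻¹, ?_⟩
    have e : (C (2 + 2 * Real.cos ψ)⁻¹ * C (2 + 2 * Real.cos ψ) : ℝ[X]) = 1 := by
      rw [← C_mul, inv_mul_cancel₀ hc, C_1]
    simp only [C_add, C_mul, C_1] at e ⊢
    linear_combination e - C (2 + 2 * Real.cos ψ)⁻¹ * (map_ofNat C 2 : (C (2 : ℝ) : ℝ[X]) = 2)
  unfold nodePoly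
  split_ifs with h1 h2 h2
  · exact absurd (h1.trans h2.symm) hne
  · exact hlin φ h2 hφ
  · exact (hlin θ h1 hθ).symm
  · set d : ℝ := (2 * (Real.cos φ - Real.cos θ))⁻¹
    have e : (C d * (C (2 * Real.cos φ) - C (2 * Real.cos θ)) : ℝ[X]) = 1 := by
      rw [← C_sub, ← C_mul, ← mul_sub, inv_mul_cancel₀, C_1]
      exact mul_ne_zero two_ne_zero (by rwa [← neg_sub, neg_ne_zero])
    refine ⟨1 - (X - C (2 * Real.cos θ)) * C d, (X - C (2 * Real.cos θ)) * C d, ?_⟩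
    rw [C_1]
    linear_combination -(X - C (2 * Real.cos θ)) * X * e

open Polynomial in
theorem aeval_ofFn {N : ℕ} (x : Fin N → ℝ) (z : ℂ) :
    aeval z (ofFn N x) = ∑ l : Fin N, (x l : ℂ) * z ^ (l : ℕ) := by
  simp [ofFn_eq_sum_monomial, aeval_monomial]

theorem exp_ofReal_mul_I_pow (θ : ℝ) (l : ℕ) : Complex.exp (θ * Complex.I) ^ l =
    (Real.cos (l * θ) : ℂ) + (Real.sin (l * θ) : ℂ) * Complex.I := by
  rw [← Complex.exp_nat_mul, ← mul_assoc, Complex.exp_mul_I]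
  push_cast; rfl

theorem aeval_ofFn_exp_re {N : ℕ} (x : Fin N → ℝ) (θ : ℝ) :
    (Polynomial.aeval (Complex.exp (θ * Complex.I)) (Polynomial.ofFn N x)).re =
      ∑ l : Fin N, x l * Real.cos (l * θ) := by
  simp [aeval_ofFn, exp_ofReal_mul_I_pow, -Complex.ofReal_cos, -Complex.ofReal_sin]

theorem aeval_ofFn_exp_im {N : ℕ} (x : Fin N → ℝ) (θ : ℝ) :
    (Polynomial.aeval (Complex.exp (θ * Complex.I)) (Polynomial.ofFn N x)).im =
      ∑ l : Fin N, x l * Real.sin (l * θ) := by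
  simp [aeval_ofFn, exp_ofReal_mul_I_pow, -Complex.ofReal_cos, -Complex.ofReal_sin]

theorem cosToeplitz_mulVec {N : ℕ} (x : Fin N → ℝ) (θ : ℝ) (s : Fin N) :
    (cosToeplitz N θ *ᵥ x) s =
      Real.cos (s * θ) *
        (Polynomial.aeval (Complex.exp (θ * Complex.I)) (Polynomial.ofFn N x)).re +
      Real.sin (s * θ) *
        (Polynomial.aeval (Complex.exp (θ * Complex.I)) (Polynomial.ofFn N x)).im := by
  rw [Matrix.mulVec, dotProduct, aeval_ofFn_exp_re, aeval_ofFn_exp_im, Finset.mul_sum,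
    Finset.mul_sum, ← Finset.sum_add_distrib]
  refine Finset.sum_congr rfl fun t _ => ?_
  rw [cosToeplitz, Matrix.of_apply, sub_mul, Real.cos_sub]; ring

theorem dotProduct_cosToeplitz_mulVec {N : ℕ} (x : Fin N → ℝ) (θ : ℝ) :
    x ⬝ᵥ cosToeplitz N θ *ᵥ x = Complex.normSq
      (Polynomial.aeval (Complex.exp (θ * Complex.I)) (Polynomial.ofFn N x)) := by
  have h1 := aeval_ofFn_exp_re x θ
  have h2 := aeval_ofFn_exp_im x θ
  simp only [dotProduct, cosToeplitz_mulVec]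
  rw [Complex.normSq_apply]
  nth_rw 3 [h1]
  nth_rw 3 [h2]
  rw [Finset.mul_sum, Finset.mul_sum, ← Finset.sum_add_distrib]
  exact Finset.sum_congr rfl fun t _ => by ring

theorem sum_smul_cosToeplitz_mulVec_eq_zero_iff {N : ℕ} {S : Finset ℝ} {c : ℝ → ℝ}
    (hc : ∀ θ ∈ S, 0 < c θ) (x : Fin N → ℝ) :
    (∑ θ ∈ S, c θ • cosToeplitz N θ) *ᵥ x = 0 ↔
      ∀ θ ∈ S, Polynomial.aeval (Complex.exp (θ * Complex.I)) (Polynomial.ofFn N x) = 0 := by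
  rw [Matrix.sum_mulVec]
  simp only [Matrix.smul_mulVec]
  constructor
  · intro h
    have h1 := congrArg (x ⬝ᵥ ·) h
    simp only [dotProduct_sum, dotProduct_smul, dotProduct_cosToeplitz_mulVec, dotProduct_zero,
      smul_eq_mul] at h1
    rw [Finset.sum_eq_zero_iff_of_nonneg
      fun θ hθ => mul_nonneg (hc θ hθ).le (Complex.normSq_nonneg _)] at h1
    exact fun θ hθ => Complex.normSq_eq_zero.mp
      ((mul_eq_zero.mp (h1 θ hθ)).resolve_left (hc θ hθ).ne')
  · intro h
    refine Finset.sum_eq_zero fun θ hθ => ?_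
    ext s
    simp [cosToeplitz_mulVec, h θ hθ]

theorem rank_sum_smul_cosToeplitz {N : ℕ} {S : Finset ℝ} {c : ℝ → ℝ}
    (hS : ∀ θ ∈ S, θ ∈ Set.Ioc 0 Real.pi) (hc : ∀ θ ∈ S, 0 < c θ)
    {u : Fin N → ℝ} (hu : u ≠ 0) (hker : (∑ θ ∈ S, c θ • cosToeplitz N θ) *ᵥ u = 0) :
    (∑ θ ∈ S, c θ • cosToeplitz N θ).rank = ∑ θ ∈ S, if θ = Real.pi then 1 else 2 := by
  set T := ∑ θ ∈ S, c θ • cosToeplitz N θ with hT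
  set Q := ∏ θ ∈ S, nodePoly θ with hQ
  have hQm : Q.Monic := Polynomial.monic_prod_of_monic _ _ fun θ _ => monic_nodePoly θ
  have hQd : Q.natDegree = ∑ θ ∈ S, if θ = Real.pi then 1 else 2 := by
    rw [hQ, Polynomial.natDegree_prod_of_monic _ _ fun θ _ => monic_nodePoly θ]
    exact Finset.sum_congr rfl fun θ _ => natDegree_nodePoly θ
  have hK : ∀ x, T *ᵥ x = 0 ↔ Q ∣ Polynomial.ofFn N x := by
    intro x
    rw [hT, sum_smul_cosToeplitz_mulVec_eq_zero_iff hc]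
    constructor
    · intro h
      exact Finset.prod_dvd_of_coprime
        (fun θ hθ φ hφ hne => isCoprime_nodePoly (hS θ hθ) (hS φ hφ) hne)
        fun θ hθ => (nodePoly_dvd_iff (hS θ hθ) _).mpr (h θ hθ)
    · intro h θ hθ
      exact (nodePoly_dvd_iff (hS θ hθ) _).mp ((Finset.dvd_prod_of_mem _ hθ).trans h)
  have hp : Polynomial.ofFn N u ≠ 0 := by
    rw [Ne, map_eq_zero_iff _ (Polynomial.injective_ofFn N)]; exact hu
  have hN : Q.natDegree ≤ N :=
    (Polynomial.natDegree_le_of_dvd ((hK u).mp hker) hp).trans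
      ((Polynomial.natDegree_lt_iff_degree_lt hp).mpr (Polynomial.ofFn_degree_lt u)).le
  have hfin := finrank_of_mem_iff_dvd_ofFn hQm hN (LinearMap.ker T.mulVecLin) (by simpa using hK)
  have hrn := T.mulVecLin.finrank_range_add_finrank_ker
  rw [hfin, Module.finrank_fin_fun] at hrn
  rw [Matrix.rank, ← hQd]
  omega

theorem even_odd_card_of_sum_eq {S : Finset ℝ} {a : ℝ} {k : ℕ}
    (h : (∑ θ ∈ S, if θ = a then 1 else 2) = k) :
    (S.erase a).card = k / 2 ∧ (Odd k ↔ a ∈ S) := by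
  have h1 : (∑ θ ∈ S.erase a, if θ = a then 1 else 2) = 2 * (S.erase a).card := by
    rw [Finset.sum_congr rfl fun θ hθ => if_neg (Finset.ne_of_mem_erase hθ), Finset.sum_const,
      smul_eq_mul, mul_comm]
  by_cases ha : a ∈ S
  · rw [← Finset.add_sum_erase _ _ ha, if_pos rfl, h1] at h
    exact ⟨by omega, iff_of_true ⟨(S.erase a).card, by omega⟩ ha⟩
  · rw [← Finset.erase_eq_of_notMem ha, h1] at h
    exact ⟨by omega, iff_of_false (by rw [Nat.not_odd_iff_even]; exact ⟨(S.erase a).card, by omega⟩) ha⟩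

theorem mem_Ioc_of_nonneg_ker {N : ℕ} {S : Finset ℝ} {u : Fin N → ℝ} (hu0 : u ≠ 0)
    (hunn : ∀ i, 0 ≤ u i) (hS : ∀ θ ∈ S, θ ∈ Set.Icc 0 Real.pi)
    (hroot : ∀ θ ∈ S, Polynomial.aeval (Complex.exp (θ * Complex.I)) (Polynomial.ofFn N u) = 0) :
    ∀ θ ∈ S, θ ∈ Set.Ioc 0 Real.pi := by
  refine fun θ hθ => ⟨(hS θ hθ).1.lt_of_ne' ?_, (hS θ hθ).2⟩
  rintro rfl
  have h := aeval_ofFn_exp_re u 0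
  rw [hroot 0 hθ] at h
  simp only [mul_zero, Real.cos_zero, mul_one, Complex.zero_re] at h
  refine hu0 (funext fun i => ?_)
  exact (Finset.sum_eq_zero_iff_of_nonneg fun i _ => hunn i).mp h.symm i (Finset.mem_univ i)

theorem statement18 (N k : ℕ) (hk : 1 ≤ k) (T : Matrix (Fin N) (Fin N) ℝ)
    (hT : T.PosSemidef)
    (hToe : ∀ s t s' t' : Fin N, (s : ℤ) - (t : ℤ) = (s' : ℤ) - (t' : ℤ) → T s t = T s' t')
    (hsing : T.det = 0) (hrank : T.rank = k)
    (u : Fin N → ℝ) (hu0 : u ≠ 0) (hunn : ∀ i, 0 ≤ u i) (huker : T.mulVec u = 0) :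
    ∃ (ζ : Fin (k / 2) → ℝ) (lam : Fin (k / 2) → ℝ) (lam0 : ℝ),
      (∀ j, ζ j ∈ Set.Ioo 0 Real.pi) ∧ Function.Injective ζ ∧
      (∀ j, 0 < lam j) ∧ 0 < lam0 ∧
      (Odd k → T = lam0 • cosToeplitz N Real.pi + ∑ j, lam j • cosToeplitz N (ζ j)) ∧
      (Even k → T = ∑ j, lam j • cosToeplitz N (ζ j)) ∧
      (∀ j, ∑ l : Fin N, (u l : ℂ) * Complex.exp (Complex.I * (ζ j : ℂ)) ^ (l : ℕ) = 0) ∧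
      (∀ j, ∑ l : Fin N, (u l : ℂ) * Complex.exp (-(Complex.I * (ζ j : ℂ))) ^ (l : ℕ) = 0) ∧
      (Odd k → ∑ l : Fin N, u l * (-1 : ℝ) ^ (l : ℕ) = 0) := by
  obtain ⟨S, c, hS, hc, hTS⟩ := exists_eq_sum_smul_cosToeplitz hT hToe
  have hroot := (sum_smul_cosToeplitz_mulVec_eq_zero_iff hc u).mp (hTS ▸ huker)
  have hS' := mem_Ioc_of_nonneg_ker hu0 hunn hS hroot
  obtain ⟨hcard, hodd⟩ := even_odd_card_of_sum_eq
    ((rank_sum_smul_cosToeplitz hS' hc hu0 (hTS ▸ huker)).symm.trans (hTS ▸ hrank))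
  set ζ := (S.erase Real.pi).orderEmbOfFin hcard
  have hmem : ∀ j, ζ j ∈ S.erase Real.pi := fun j => Finset.orderEmbOfFin_mem _ hcard j
  have hmemS : ∀ j, ζ j ∈ S := fun j => Finset.mem_of_mem_erase (hmem j)
  have hsum : ∑ j, c (ζ j) • cosToeplitz N (ζ j) =
      ∑ θ ∈ S.erase Real.pi, c θ • cosToeplitz N θ := by
    rw [← Finset.map_orderEmbOfFin_univ _ hcard, Finset.sum_map]
    rfl
  refine ⟨ζ, fun j => c (ζ j), if Real.pi ∈ S then c Real.pi else 1, fun j => ?_, ζ.injective,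
    fun j => hc _ (hmemS j), ?_, fun hk => ?_, fun hk => ?_, fun j => ?_, fun j => ?_, fun hk => ?_⟩
  · exact ⟨(hS' _ (hmemS j)).1,
      (hS' _ (hmemS j)).2.lt_of_ne (Finset.ne_of_mem_erase (hmem j))⟩
  · split_ifs with h
    exacts [hc _ h, one_pos]
  · rw [if_pos (hodd.mp hk), hsum, hTS]
    exact (Finset.add_sum_erase S (fun θ => c θ • cosToeplitz N θ) (hodd.mp hk)).symm
  · rw [hsum, Finset.erase_eq_of_notMem (by rwa [← hodd, Nat.not_odd_iff_even])]
    exact hTS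
  · rw [mul_comm, ← aeval_ofFn]
    exact hroot _ (hmemS j)
  · have h := congrArg (starRingEnd ℂ) (hroot _ (hmemS j))
    rw [aeval_ofFn, map_sum, map_zero] at h
    rw [← h]
    refine Finset.sum_congr rfl fun l _ => ?_
    rw [map_mul, map_pow, ← Complex.exp_conj, map_mul, Complex.conj_ofReal, Complex.conj_ofReal,
      Complex.conj_I, mul_neg, mul_comm Complex.I]
  · have h := aeval_ofFn_exp_re u Real.pi
    rw [hroot _ (hodd.mp hk)] at h
    simpa [Real.cos_nat_mul_pi] using h.symm
end

section
/- Let n ≥ 5 be odd and set m = (n−3)/2. Let ζ₁ < ζ₂ < … < ζ_m be distinct angles in (0,π) such that the fractional part of nζ_j/(4π) lies in (0,1/2) for odd j and in (1/2,1) for even j. Let u ∈ ℝ^{n−2} be the coefficient vector of the polynomial p(x) = Π_{j=1}^{m}(x² − 2x cos ζ_j + 1), and let L be the linear subspace of real symmetric n×n matrices A such that A_{I_j} u = 0 for all j = 1,…,n, where A_{I_j} is the principal submatrix of A with rows and columns indexed by the cyclically ordered set I_j. If dim L > 1, then ζ_j = (2j−1)π/n for all j = 1,…,m; in particular, the vector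 u then has at least one negative entry. -/
open Matrix

/-- Power sums that vanish for enough exponents force the coefficient of every isolated node to
vanish. -/
lemma coeff_eq_zero_of_power_sums {κ : Type*} (S : Finset κ) (w y : κ → ℂ) (D : ℕ)
    (hS : S.card ≤ D) (h : ∀ s < D, ∑ i ∈ S, y i * w i ^ s = 0) (i₀ : κ) (hi₀ : i₀ ∈ S)
    (hw : ∀ i ∈ S, i ≠ i₀ → w i ≠ w i₀) : y i₀ = 0 := by
  classical
  have hpoly : ∀ q : Polynomial ℂ, q.natDegree < D → ∑ i ∈ S, y i * q.eval (w i) = 0 := by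
    intro q hq
    simp_rw [Polynomial.eval_eq_sum_range' hq, Finset.mul_sum]
    rw [Finset.sum_comm]
    refine Finset.sum_eq_zero fun s hs => ?_
    have := h s (Finset.mem_range.1 hs)
    calc _ = q.coeff s * ∑ i ∈ S, y i * w i ^ s := by
          rw [Finset.mul_sum]; exact Finset.sum_congr rfl fun i _ => by ring
      _ = 0 := by rw [this, mul_zero]
  have hq := hpoly (∏ i ∈ S.erase i₀, (Polynomial.X - Polynomial.C (w i))) (by
    rw [Polynomial.natDegree_finsetProd_X_sub_C_eq_card, Finset.card_erase_of_mem hi₀]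
    have := Finset.card_pos.2 ⟨i₀, hi₀⟩
    omega)
  rw [Finset.sum_eq_single_of_mem i₀ hi₀] at hq
  · refine (mul_eq_zero.1 hq).resolve_right ?_
    rw [Polynomial.eval_prod]
    refine Finset.prod_ne_zero_iff.2 ?_
    intro i hi
    rw [Finset.mem_erase] at hi
    simpa [sub_eq_zero] using (hw i hi.2 hi.1).symm
  · intro i hi hne
    rw [Polynomial.eval_prod, Finset.prod_eq_zero (Finset.mem_erase.2 ⟨hne, hi⟩) (by simp),
      mul_zero]

/-- A finite sequence satisfying a linear recurrence with simple characteristic roots is a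
combination of the powers of these roots. -/
lemma exists_exponential_sum {ι : Type*} [Fintype ι] {N : ℕ}
    (hcard : Fintype.card ι = N) (w : ℕ → ℂ) (hw : w N = 1) (z : ι → ℂ)
    (hz : Function.Injective z) (hroot : ∀ i, ∑ l ∈ Finset.range (N + 1), w l * z i ^ l = 0)
    (X : ℕ → ℂ) (L : ℕ) (hrec : ∀ j ≤ L, ∑ l ∈ Finset.range (N + 1), X (j + l) * w l = 0) :
    ∃ x : ι → ℂ, ∀ s ≤ L + N, X s = ∑ i, x i * z i ^ s := by
  let f : (ι → ℂ) →ₗ[ℂ] (Fin N → ℂ) :=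
    { toFun := fun x s => ∑ i, x i * z i ^ (s : ℕ)
      map_add' := fun x y => by ext s; simp [add_mul, Finset.sum_add_distrib]
      map_smul' := fun c x => by ext s; simp [mul_assoc, Finset.mul_sum] }
  have hinj : Function.Injective f := by
    rw [← LinearMap.ker_eq_bot, LinearMap.ker_eq_bot']
    intro x hx
    ext i
    refine coeff_eq_zero_of_power_sums Finset.univ z x N (by simp [hcard]) (fun s hs => ?_) i
      (Finset.mem_univ _) fun j _ hj => hz.ne hj
    exact congrFun hx ⟨s, hs⟩
  have hsurj : Function.Surjective f :=
    (LinearMap.injective_iff_surjective_of_finrank_eq_finrank (by simp [hcard])).1 hinj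
  obtain ⟨x, hx⟩ := hsurj fun s => X s
  refine ⟨x, fun s => ?_⟩
  induction s using Nat.strong_induction_on with
  | _ s ih =>
    intro hs
    rcases lt_or_ge s N with h | h
    · exact (congrFun hx ⟨s, h⟩).symm
    · obtain ⟨j, rfl⟩ := Nat.exists_eq_add_of_le' h
      have h1 := hrec j (by omega)
      have h2 : ∑ l ∈ Finset.range (N + 1), (∑ i, x i * z i ^ (j + l)) * w l = 0 := by
        simp_rw [Finset.sum_mul]
        rw [Finset.sum_comm]
        refine Finset.sum_eq_zero fun i _ => ?_
        calc _ = x i * z i ^ j * ∑ l ∈ Finset.range (N + 1), w l * z i ^ l := by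
              rw [Finset.mul_sum]; exact Finset.sum_congr rfl fun l _ => by ring
          _ = 0 := by rw [hroot, mul_zero]
      rw [Finset.sum_range_succ, hw] at h1 h2
      have h3 : ∑ l ∈ Finset.range N, X (j + l) * w l =
          ∑ l ∈ Finset.range N, (∑ i, x i * z i ^ (j + l)) * w l :=
        Finset.sum_congr rfl fun l hl => by
          rw [Finset.mem_range] at hl
          rw [ih (j + l) (by omega) (by omega)]
      rw [h3] at h1
      linear_combination h1 - h2

/-- The conditions satisfied by a Fourier mode, with character `ω`, of the diagonals of a symmetric
matrix whose cyclic principal submatrices annihilate the vector with entries `w`. -/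
structure CyclicMode (n N : ℕ) (w : ℕ → ℂ) (ω : ℂ) (X : ℤ → ℂ) : Prop where
  periodic : ∀ t, X (t + n) = X t
  symm : ∀ t, X t = ω ^ t * X (-t)
  recurrence : ∀ t : ℤ, -N ≤ t → t ≤ 0 → ∑ l ∈ Finset.range (N + 1), X (t + l) * w l = 0

/-- The points `z i` are the simple roots of the palindromic polynomial with coefficients `w`,
paired with their inverses by `σ`, and none is an `n`-th root of unity. -/
structure RootSystem {ι : Type*} [Fintype ι] (n N : ℕ) (w : ℕ → ℂ) (z : ι → ℂ) (σ : ι → ι) :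
    Prop where
  hn : n = N + 3
  card : Fintype.card ι = N
  lead : w N = 1
  inj : Function.Injective z
  root : ∀ i, ∑ l ∈ Finset.range (N + 1), w l * z i ^ l = 0
  ne_zero : ∀ i, z i ≠ 0
  inv : ∀ i, z (σ i) = (z i)⁻¹
  ne_self : ∀ i, σ i ≠ i
  pow_ne : ∀ i, z i ^ n ≠ 1

namespace CyclicMode

variable {ι : Type*} [Fintype ι] {n N : ℕ} {w : ℕ → ℂ} {z : ι → ℂ} {σ : ι → ι}
  {ω : ℂ} {X : ℤ → ℂ}

lemma exists_rep (hR : RootSystem n N w z σ) (hX : CyclicMode n N w ω X) :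
    ∃ x : ι → ℂ, ∀ s : ℕ, s ≤ 2 * N → X ((s : ℤ) - N) = ∑ i, x i * z i ^ s := by
  obtain ⟨x, hx⟩ := exists_exponential_sum hR.card w hR.lead z hR.inj hR.root
    (fun s => X ((s : ℤ) - N)) N (fun j hj => by
      rw [← hX.recurrence ((j : ℤ) - N) (by omega) (by omega)]
      refine Finset.sum_congr rfl fun l _ => ?_
      push_cast
      rw [show (j : ℤ) + l - N = j - N + l by ring])
  exact ⟨x, fun s hs => hx s (by omega)⟩

lemma eq_zero_of_rep_zero (hR : RootSystem n N w z σ) (hX : CyclicMode n N w ω X)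
    (hN : 2 ≤ N) (h : ∀ s : ℕ, s ≤ 2 * N → X ((s : ℤ) - N) = 0) : X = 0 := by
  have hper : Function.Periodic X (n : ℤ) := hX.periodic
  have hn := hR.hn
  funext t
  have h1 : X t = X ((t + 2) % n - 2) := by
    have : (t + 2) % n - 2 = t - (t + 2) / n * n := by
      have := Int.emod_add_mul_ediv (t + 2) n
      linear_combination this
    rw [this, ← smul_eq_mul, hper.sub_zsmul_eq]
  have h2 := Int.emod_nonneg (t + 2) (b := n) (by omega)
  have h3 := Int.emod_lt_of_pos (t + 2) (b := n) (by omega)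
  have h4 := h ((t + 2) % n - 2 + N).toNat (by omega)
  rw [Int.toNat_of_nonneg (by omega)] at h4
  rw [h1, Pi.zero_apply, ← h4]
  congr 1
  ring

lemma rep_eq_zero (hR : RootSystem n N w z σ) (hX : CyclicMode n N w ω X) {x : ι → ℂ}
    (hx : ∀ s : ℕ, s ≤ 2 * N → X ((s : ℤ) - N) = ∑ i, x i * z i ^ s) {i₁ i₂ : ι} (hne : i₁ ≠ i₂)
    (h1 : x i₁ = 0) (h2 : x i₂ = 0) : x = 0 := by
  classical
  have hn := hR.hn
  funext i
  by_cases hi1 : i = i₁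
  · rw [hi1, h1]; rfl
  by_cases hi2 : i = i₂
  · rw [hi2, h2]; rfl
  have key := coeff_eq_zero_of_power_sums ((Finset.univ.erase i₁).erase i₂) z
    (fun i => x i * (z i ^ n - 1)) (N - 2) (by
      rw [Finset.card_erase_of_mem (by simp [hne.symm]), Finset.card_erase_of_mem (by simp),
        Finset.card_univ, hR.card]
      omega) (fun s hs => by
      have hs1 := hx (s + n) (by omega)
      have hs2 := hx s (by omega)
      have hp := hX.periodic ((s : ℤ) - N)
      rw [Finset.sum_erase _ (by simp [h2]), Finset.sum_erase _ (by simp [h1])]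
      rw [show (s : ℤ) - N + n = ((s + n : ℕ) : ℤ) - N by push_cast; ring, hs1, hs2] at hp
      rw [← sub_eq_zero, ← Finset.sum_sub_distrib] at hp
      rw [← hp]
      exact Finset.sum_congr rfl fun i _ => by ring) i (by simp [hi1, hi2])
    fun j _ hj => hR.inj.ne hj
  exact (mul_eq_zero.1 key).resolve_right (sub_ne_zero.2 (hR.pow_ne i))

lemma rep_symm (hR : RootSystem n N w z σ) (hX : CyclicMode n N w ω X) (hω : ω ≠ 0) {x : ι → ℂ}
    (hx : ∀ s : ℕ, s ≤ 2 * N → X ((s : ℤ) - N) = ∑ i, x i * z i ^ s) {s : ℕ} (hs : s ≤ 2 * N) :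
    ∑ i, x i * z i ^ s = ∑ i, (ω ^ N)⁻¹ * x i * z i ^ (2 * N) * (ω / z i) ^ s := by
  have h1 := hX.symm ((s : ℤ) - N)
  rw [show -((s : ℤ) - N) = ((2 * N - s : ℕ) : ℤ) - N by push_cast [hs]; ring, hx s hs,
    hx (2 * N - s) (by omega), zpow_sub₀ hω, zpow_natCast, zpow_natCast, Finset.mul_sum] at h1
  rw [h1]
  refine Finset.sum_congr rfl fun i _ => ?_
  have hz := hR.ne_zero i
  rw [pow_sub₀ _ hz hs, div_pow]
  field_simp

/-- If a nonzero mode with character `ω` exists, then multiplication by `ω` preserves the roots up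
to one exception. -/
lemma exists_rotation [Nonempty ι] (hR : RootSystem n N w z σ) (hX : CyclicMode n N w ω X)
    (hω : ω ≠ 0) (hN : 2 ≤ N) (hne : X ≠ 0) : ∃ i₀, ∀ i ≠ i₀, ∃ j, z i = ω * z j := by
  obtain ⟨x, hx⟩ := hX.exists_rep hR
  have hx0 : x ≠ 0 := fun h => hne (hX.eq_zero_of_rep_zero hR hN fun s hs => by
    rw [hx s hs]; simp [h])
  have hone : ∃ i₀, ∀ i ≠ i₀, x i ≠ 0 := by
    by_cases h : ∃ i₀, x i₀ = 0
    · obtain ⟨i₀, h⟩ := h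
      exact ⟨i₀, fun i hi hi0 => hx0 (hX.rep_eq_zero hR hx hi hi0 h)⟩
    · push Not at h
      exact ⟨Classical.arbitrary ι, fun i _ => h i⟩
  obtain ⟨i₀, hi₀⟩ := hone
  refine ⟨i₀, fun i hi => ?_⟩
  by_contra! hcon
  refine hi₀ i hi ?_
  refine coeff_eq_zero_of_power_sums (κ := ι ⊕ ι) Finset.univ (Sum.elim z fun j => ω / z j)
    (Sum.elim x fun j => -((ω ^ N)⁻¹ * x j * z j ^ (2 * N))) (2 * N) (by
      simp [hR.card]; omega) (fun s hs => ?_) (Sum.inl i) (Finset.mem_univ _) ?_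
  · rw [Fintype.sum_sum_type]
    simp only [Sum.elim_inl, Sum.elim_inr]
    rw [hX.rep_symm hR hω hx hs.le, ← Finset.sum_add_distrib]
    exact Finset.sum_eq_zero fun j _ => by ring
  · rintro (j | j) - hj
    · exact hR.inj.ne fun h => hj (by rw [h])
    · have := hcon (σ j)
      rw [hR.inv, ← div_eq_mul_inv] at this
      exact this.symm

/-- The modes with trivial character form a space of dimension at most one. -/
lemma exists_dependence [Nonempty ι] {Y : ℤ → ℂ} (hR : RootSystem n N w z σ)
    (hX : CyclicMode n N w 1 X) (hY : CyclicMode n N w 1 Y) (hN : 2 ≤ N) :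
    ∃ a b : ℂ, (a ≠ 0 ∨ b ≠ 0) ∧ ∀ t, a * X t + b * Y t = 0 := by
  obtain ⟨x, hx⟩ := hX.exists_rep hR
  obtain ⟨y, hy⟩ := hY.exists_rep hR
  let i₀ : ι := Classical.arbitrary ι
  obtain ⟨a, b, hab, h0⟩ : ∃ a b : ℂ, (a ≠ 0 ∨ b ≠ 0) ∧ a * x i₀ + b * y i₀ = 0 := by
    by_cases h : x i₀ = 0
    · exact ⟨1, 0, by simp, by simp [h]⟩
    · exact ⟨y i₀, -x i₀, by simp [h], by ring⟩
  have hZ : CyclicMode n N w 1 fun t => a * X t + b * Y t :=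
    { periodic := fun t => by rw [hX.periodic, hY.periodic]
      symm := fun t => by
        have h1 := hX.symm t
        have h2 := hY.symm t
        rw [_root_.one_zpow, one_mul] at h1 h2 ⊢
        rw [h1, h2]
      recurrence := fun t h1 h2 => by
        have e1 := hX.recurrence t h1 h2
        have e2 := hY.recurrence t h1 h2
        calc _ = a * ∑ l ∈ Finset.range (N + 1), X (t + l) * w l
              + b * ∑ l ∈ Finset.range (N + 1), Y (t + l) * w l := by
              rw [Finset.mul_sum, Finset.mul_sum, ← Finset.sum_add_distrib]
              exact Finset.sum_congr rfl fun l _ => by ring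
          _ = 0 := by rw [e1, e2]; ring }
  have hz : ∀ s : ℕ, s ≤ 2 * N →
      a * X ((s : ℤ) - N) + b * Y ((s : ℤ) - N) = ∑ i, (a * x i + b * y i) * z i ^ s := by
    intro s hs
    rw [hx s hs, hy s hs, Finset.mul_sum, Finset.mul_sum, ← Finset.sum_add_distrib]
    exact Finset.sum_congr rfl fun l _ => by ring
  have hinvol : Function.Involutive σ := fun i => hR.inj (by rw [hR.inv, hR.inv, inv_inv])
  have h1 : a * x (σ i₀) + b * y (σ i₀) = 0 := by
    have := coeff_eq_zero_of_power_sums Finset.univ z (fun i => a * x i + b * y i -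
      (a * x (σ i) + b * y (σ i)) * z (σ i) ^ (2 * N)) N (by simp [hR.card]) (fun s hs => by
      have e1 := hZ.rep_symm hR one_ne_zero hz (s := s) (by omega)
      have e2 : ∑ i, (a * x (σ i) + b * y (σ i)) * z (σ i) ^ (2 * N) * z i ^ s =
          ∑ i, (1 ^ N)⁻¹ * (a * x i + b * y i) * z i ^ (2 * N) * (1 / z i) ^ s := by
        rw [← Equiv.sum_comp hinvol.toPerm]
        refine Finset.sum_congr rfl fun i _ => ?_
        simp only [Function.Involutive.coe_toPerm]
        rw [hinvol i, hR.inv i]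
        simp
      simp_rw [sub_mul]
      rw [Finset.sum_sub_distrib, e1, e2, sub_self]) (σ i₀) (Finset.mem_univ _)
      fun j _ hj => hR.inj.ne hj
    simpa [hinvol i₀, h0] using this
  have h2 := hZ.rep_eq_zero hR hz (hR.ne_self i₀) h1 h0
  refine ⟨a, b, hab, fun t => ?_⟩
  refine congrFun (hZ.eq_zero_of_rep_zero hR hN fun s hs => ?_) t
  rw [hz s hs]
  exact Finset.sum_eq_zero fun i _ => by rw [show a * x i + b * y i = 0 from congrFun h2 i, zero_mul]

end CyclicMode

/-- An integer-indexed symmetric periodic kernel whose cyclic principal windows annihilate the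
vector with entries `w`. -/
structure CyclicKernel (n N : ℕ) (w : ℕ → ℂ) (M : ℤ → ℤ → ℂ) : Prop where
  periodic : ∀ a b, M a (b + n) = M a b
  symm : ∀ a b, M a b = M b a
  annihilates : ∀ (j : ℤ) (s : ℕ), s ≤ N →
    ∑ l ∈ Finset.range (N + 1), M (j + s) (j + l) * w l = 0

/-- The Fourier transform of the `t`-th cyclic diagonal of `M` at the character `ω`. -/
noncomputable def fourierMode (n : ℕ) (M : ℤ → ℤ → ℂ) (ω : ℂ) (t : ℤ) : ℂ :=
  ∑ i ∈ Finset.range n, ω ^ (-(i : ℤ)) * M i (i + t)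

lemma sum_range_add_int {n : ℕ} {g : ℤ → ℂ} (hg : Function.Periodic g (n : ℤ)) (t : ℤ) :
    ∑ i ∈ Finset.range n, g (i + t) = ∑ i ∈ Finset.range n, g i := by
  have step : ∀ t : ℤ, ∑ i ∈ Finset.range n, g (i + (t + 1)) =
      ∑ i ∈ Finset.range n, g (i + t) := by
    intro t
    have h1 := Finset.sum_range_succ (fun i : ℕ => g (i + t)) n
    have h2 := Finset.sum_range_succ' (fun i : ℕ => g (i + t)) n
    have h3 : g ((n : ℤ) + t) = g ((0 : ℕ) + t) := by
      rw [add_comm, hg, Nat.cast_zero, zero_add]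
    rw [h1, h3] at h2
    rw [add_right_cancel h2]
    refine Finset.sum_congr rfl fun i _ => ?_
    push_cast
    rw [add_assoc, add_comm 1 t]
  induction t using Int.induction_on with
  | zero => simp
  | succ t ih => rw [step, ih]
  | pred t ih => rw [← ih, ← step, sub_add_cancel]

namespace CyclicKernel

variable {n N : ℕ} {w : ℕ → ℂ} {M : ℤ → ℤ → ℂ} {ω : ℂ}

lemma periodic_left (hM : CyclicKernel n N w M) (a b : ℤ) : M (a + n) b = M a b := by
  rw [hM.symm, hM.periodic, hM.symm]

lemma cyclicMode (hM : CyclicKernel n N w M) (hω : ω ≠ 0) (hωn : ω ^ n = 1) :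
    CyclicMode n N w ω (fourierMode n M ω) where
  periodic t := Finset.sum_congr rfl fun i _ => by rw [← add_assoc, hM.periodic]
  symm t := by
    have hper : Function.Periodic (fun i : ℤ => ω ^ (-i) * M i (i + t)) (n : ℤ) := by
      intro i
      simp only
      rw [neg_add, zpow_add₀ hω, zpow_neg ω (n : ℤ), zpow_natCast, hωn, add_right_comm,
        hM.periodic, hM.periodic_left]
      simp
    have := sum_range_add_int hper (-t)
    rw [fourierMode, ← this, fourierMode, Finset.mul_sum]
    refine Finset.sum_congr rfl fun i _ => ?_
    rw [neg_add, zpow_add₀ hω, neg_neg, neg_add_cancel_right, hM.symm]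
    ring
  recurrence t h1 h2 := by
    simp_rw [fourierMode, Finset.sum_mul]
    rw [Finset.sum_comm]
    refine Finset.sum_eq_zero fun i _ => ?_
    have := hM.annihilates (i + t) (-t).toNat (by omega)
    rw [Int.toNat_of_nonneg (by omega)] at this
    calc _ = ω ^ (-(i : ℤ)) *
          ∑ l ∈ Finset.range (N + 1), M (i + t + -t) (i + t + l) * w l := by
          rw [Finset.mul_sum]
          refine Finset.sum_congr rfl fun l _ => ?_
          rw [add_neg_cancel_right, add_assoc, mul_assoc]
      _ = 0 := by rw [this, mul_zero]

lemma emod_left (hM : CyclicKernel n N w M) (a b : ℤ) : M (a % n) b = M a b := by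
  have hper : Function.Periodic (fun a => M a b) (n : ℤ) := fun a => hM.periodic_left a b
  have : a % n = a - (a / n) • (n : ℤ) := by
    have := Int.emod_add_mul_ediv a n
    rw [smul_eq_mul]
    linear_combination this
  rw [this]
  exact hper.sub_zsmul_eq (a / n)

/-- Two linearly independent kernels produce a nontrivial rotation preserving the roots up to one
exception. -/
lemma exists_rotation {ι : Type*} [Fintype ι] [Nonempty ι] {z : ι → ℂ} {σ : ι → ι}
    {A B : ℤ → ℤ → ℂ} (hR : RootSystem n N w z σ) (hN : 2 ≤ N) (hA : CyclicKernel n N w A)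
    (hB : CyclicKernel n N w B) {ρ : ℂ} (hρ : IsPrimitiveRoot ρ n)
    (hind : ∀ a b : ℂ, (∀ i j, a * A i j + b * B i j = 0) → a = 0 ∧ b = 0) :
    ∃ k : ℕ, 0 < k ∧ k < n ∧ ∃ i₀, ∀ i ≠ i₀, ∃ j, z i = ρ ^ k * z j := by
  have hn : n ≠ 0 := by have := hR.hn; omega
  have hρ0 : ρ ≠ 0 := hρ.ne_zero hn
  have hρn : ∀ k : ℕ, (ρ ^ k) ^ n = 1 := fun k => by
    rw [← pow_mul, mul_comm, pow_mul, hρ.pow_eq_one, one_pow]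
  by_contra! hcon
  have hzero : ∀ M, CyclicKernel n N w M → ∀ k : ℕ, 0 < k → k < n →
      fourierMode n M (ρ ^ k) = 0 := by
    intro M hM k h1 h2
    by_contra h
    obtain ⟨i₀, hi₀⟩ :=
      (hM.cyclicMode (pow_ne_zero k hρ0) (hρn k)).exists_rotation hR (pow_ne_zero k hρ0) hN h
    obtain ⟨i, hi, hi'⟩ := hcon k h1 h2 i₀
    obtain ⟨j, hj⟩ := hi₀ i hi
    exact hi' j hj
  obtain ⟨a, b, hab, h0⟩ := (hA.cyclicMode one_ne_zero (one_pow n)).exists_dependence hR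
    (hB.cyclicMode one_ne_zero (one_pow n)) hN
  have hdiag : ∀ (t : ℤ) (i : ℕ), i < n → a * A i (i + t) + b * B i (i + t) = 0 := by
    intro t i hi
    refine coeff_eq_zero_of_power_sums (Finset.range n) (fun i => ρ ^ (-(i : ℤ)))
      (fun i => a * A i (i + t) + b * B i (i + t)) n (by simp) (fun k hk => ?_) i
      (Finset.mem_range.2 hi) fun j hj hji h => ?_
    · have key : a * fourierMode n A (ρ ^ k) t + b * fourierMode n B (ρ ^ k) t = 0 := by
        rcases Nat.eq_zero_or_pos k with rfl | hk0
        · rw [pow_zero]; exact h0 t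
        · rw [hzero A hA k hk0 hk, hzero B hB k hk0 hk]; simp
      rw [fourierMode, fourierMode, Finset.mul_sum, Finset.mul_sum,
        ← Finset.sum_add_distrib] at key
      rw [← key]
      refine Finset.sum_congr rfl fun i _ => ?_
      have : (ρ ^ (-(i : ℤ))) ^ k = (ρ ^ k) ^ (-(i : ℤ)) := by
        rw [← zpow_natCast, ← zpow_natCast, ← _root_.zpow_mul,
          ← _root_.zpow_mul, mul_comm]
      rw [this]
      ring
    · rw [_root_.zpow_neg, _root_.zpow_neg, zpow_natCast, zpow_natCast] at h
      exact hji (hρ.pow_inj (Finset.mem_range.1 hj) hi (inv_injective h))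
  have := hind a b fun i j => by
    have h1 := Int.emod_nonneg i (b := n) (by omega)
    have h2 := Int.emod_lt_of_pos i (b := n) (by omega)
    have := hdiag (j - i % n) (i % n).toNat (by omega)
    rwa [Int.toNat_of_nonneg h1, add_sub_cancel, hA.emod_left, hB.emod_left] at this
  exact hab.elim (fun h => h this.1) (fun h => h this.2)

end CyclicKernel

/-- Scaled positions `y j` and their negatives, up to one exception preserved modulo `n` by the
translation by `k`. -/
def AlmostInvariant {m : ℕ} (n : ℕ) (y : Fin m → ℝ) (k : ℤ) : Prop :=
  ∃ i₀, ∀ i ≠ i₀, ∃ j, ∃ q : ℤ,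
    Sum.elim y (fun j => -y j) i = Sum.elim y (fun j => -y j) j + k + n * q

lemma AlmostInvariant.neg {m n : ℕ} {y : Fin m → ℝ} {k : ℤ} (h : AlmostInvariant n y k) :
    AlmostInvariant n y (n - k) := by
  obtain ⟨i₀, h⟩ := h
  have hswap : ∀ i : Fin m ⊕ Fin m, Sum.elim y (fun j => -y j) i.swap =
      -Sum.elim y (fun j => -y j) i := by
    rintro (i | i) <;> simp
  refine ⟨i₀.swap, fun i hi => ?_⟩
  obtain ⟨j, q, hq⟩ := h i.swap fun h => hi (by rw [← h, Sum.swap_swap])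
  refine ⟨j.swap, -q - 1, ?_⟩
  rw [hswap] at hq ⊢
  push_cast
  linear_combination -hq

/-- The unit cells containing the points `y j` and their negatives. -/
def cell {m : ℕ} (a : Fin m → ℤ) : Fin m ⊕ Fin m → ℤ := Sum.elim a fun j => -a j - 1

lemma cell_eq_add {m n : ℕ} {y : Fin m → ℝ} {a : Fin m → ℤ}
    (ha : ∀ j, (a j : ℝ) < y j ∧ y j < a j + 1) {i j : Fin m ⊕ Fin m} {k q : ℤ}
    (h : Sum.elim y (fun j => -y j) i = Sum.elim y (fun j => -y j) j + k + n * q) :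
    cell a i = cell a j + k + n * q := by
  have hc : ∀ i, (cell a i : ℝ) < Sum.elim y (fun j => -y j) i ∧
      Sum.elim y (fun j => -y j) i < cell a i + 1 := by
    rintro (i | i)
    · exact ha i
    · have := ha i
      simp only [cell, Sum.elim_inr]
      push_cast
      constructor <;> linarith
  have h1 : (cell a i : ℝ) < ((cell a j + k + n * q + 1 : ℤ) : ℝ) := by
    push_cast
    linarith [(hc i).1, (hc j).2]
  have h2 : ((cell a j + k + n * q : ℤ) : ℝ) < ((cell a i + 1 : ℤ) : ℝ) := by
    push_cast
    linarith [(hc i).2, (hc j).1]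
  have h1 := Int.cast_lt.1 h1
  have h2 := Int.cast_lt.1 h2
  omega

/-- Strictly increasing points with alternating cell parities either fill an initial segment of
cells or reach the central cell. -/
lemma cells_alternative {m n : ℕ} (hn : n = 2 * m + 3) {y : Fin m → ℝ} {a : Fin m → ℤ}
    (hy : StrictMono y) (ha : ∀ j, (a j : ℝ) < y j ∧ y j < a j + 1)
    (hpar : ∀ j : Fin m, (a j - (j : ℕ)) % 2 = 0) (hpos : ∀ j, 0 < y j)
    (hlt : ∀ j, y j < n / 2) :
    StrictMono a ∧ (∀ j, 0 ≤ a j ∧ a j ≤ m + 1) ∧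
      ((∀ j, a j = (j : ℕ)) ∨ ∃ T, a T = m + 1) := by
  have hstep : ∀ d : ℕ, ∀ i j : Fin m, (j : ℕ) = i + d → a i + d ≤ a j := by
    intro d
    induction d with
    | zero =>
      intro i j h
      rw [show j = i from Fin.ext (by simpa using h)]
      simp
    | succ d ih =>
      intro i j h
      have h1 := ih i ⟨i + d, by omega⟩ rfl
      set l : Fin m := ⟨i + d, by omega⟩ with hl
      have h2 : y l < y j := hy (by rw [Fin.lt_def, hl]; simp only; omega)
      have h3 : (a l : ℝ) < ((a j + 1 : ℤ) : ℝ) := by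
        push_cast
        linarith [(ha l).1, (ha j).2]
      have h3 := Int.cast_lt.1 h3
      have h4 := hpar l
      have h5 := hpar j
      have h6 : (l : ℕ) = i + d := rfl
      omega
  have hbound : ∀ j, 0 ≤ a j ∧ a j ≤ m + 1 := by
    intro j
    have h1 : ((0 : ℤ) : ℝ) < ((a j + 1 : ℤ) : ℝ) := by
      push_cast
      linarith [(ha j).2, hpos j]
    have h2 : ((2 * a j : ℤ) : ℝ) < ((2 * m + 3 : ℤ) : ℝ) := by
      have : (n : ℝ) = 2 * m + 3 := by rw [hn]; push_cast; ring
      push_cast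
      linarith [(ha j).1, hlt j]
    have h1 := Int.cast_lt.1 h1
    have h2 := Int.cast_lt.1 h2
    omega
  refine ⟨fun i j hij => ?_, hbound, ?_⟩
  · have := hstep (j - i) i j (by rw [Fin.lt_def] at hij; omega)
    rw [Fin.lt_def] at hij
    omega
  · rcases Nat.eq_zero_or_pos m with rfl | hm
    · exact Or.inl fun j => j.elim0
    by_cases hT : a ⟨m - 1, by omega⟩ = m + 1
    · exact Or.inr ⟨_, hT⟩
    · left
      intro j
      have h1 := hstep j ⟨0, hm⟩ j (by simp)
      have h2 := hstep (m - 1 - j) j ⟨m - 1, by omega⟩ (by simp only; omega)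
      have h3 := hpar ⟨m - 1, by omega⟩
      have h4 := hbound ⟨m - 1, by omega⟩
      have h5 := hbound ⟨0, hm⟩
      simp only at h3
      omega

/-- If the central cell is occupied, there is no nontrivial almost invariance. -/
lemma not_almostInvariant_of_central {m n : ℕ} (hn : n = 2 * m + 3) {y : Fin m → ℝ}
    {a : Fin m → ℤ} (ha : ∀ j, (a j : ℝ) < y j ∧ y j < a j + 1) (hmono : StrictMono a)
    (hbound : ∀ j, 0 ≤ a j ∧ a j ≤ m + 1) (hpos : ∀ j, 0 < y j) (hlt : ∀ j, y j < n / 2)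
    {T : Fin m} (hT : a T = m + 1) {k : ℤ} (hk : ¬ (n : ℤ) ∣ k) : ¬ AlmostInvariant n y k := by
  classical
  rintro ⟨i₀, h⟩
  have : NeZero n := ⟨by omega⟩
  have hcast : ∀ c d : ℤ, (c : ZMod n) = d ↔ ∃ q : ℤ, c = d + n * q := fun c d => by
    rw [eq_comm, ZMod.intCast_eq_intCast_iff_dvd_sub]
    exact exists_congr fun q => by constructor <;> intro h <;> linarith
  have hq : ∀ x q : ℤ, 0 < x → x < 2 * n → x = n * q → x = n := by
    intro x q h1 h2 h3
    have h4 : 0 < q := by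
      by_contra! h; nlinarith
    have h5 : q < 2 := by
      by_contra! h; nlinarith
    rw [h3, show q = 1 by omega, mul_one]
  have hcoll : ∀ i j, i ≠ j → (cell a i : ZMod n) = cell a j →
      (cell a i : ZMod n) = (m + 1 : ℤ) ∧
        ((i = Sum.inl T ∧ j = Sum.inr T) ∨ (i = Sum.inr T ∧ j = Sum.inl T)) := by
    have hsame : ∀ i j q, a i = a j + n * q → i = j := by
      intro i j q hij
      have hi := hbound i
      have hj := hbound j
      refine hmono.injective ?_
      have := hq (a i - a j + n) (q + 1) (by omega) (by omega) (by linarith)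
      omega
    have hopp : ∀ i j q, a i = -a j - 1 + n * q → i = T ∧ j = T := by
      intro i j q hij
      have hi := hbound i
      have hj := hbound j
      have := hq (a i + a j + 1) q (by omega) (by omega) (by linarith)
      exact ⟨hmono.injective (by omega), hmono.injective (by omega)⟩
    rintro (i | i) (j | j) hij hc <;> obtain ⟨q, hc'⟩ := (hcast _ _).1 hc <;>
      simp only [cell, Sum.elim_inl, Sum.elim_inr] at hc'
    · exact absurd (congrArg Sum.inl (hsame i j q hc')) hij
    · obtain ⟨rfl, rfl⟩ := hopp i j q hc'
      exact ⟨by simp [cell, hT], Or.inl ⟨rfl, rfl⟩⟩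
    · obtain ⟨rfl, rfl⟩ := hopp j i (-q) (by linarith)
      exact ⟨by rw [hc]; simp [cell, hT], Or.inr ⟨rfl, rfl⟩⟩
    · exact absurd (congrArg Sum.inr (hsame i j (-q) (by linarith))) hij
  have hTc : (cell a (Sum.inl T) : ZMod n) = cell a (Sum.inr T) := by
    rw [hcast]
    refine ⟨1, ?_⟩
    simp only [cell, Sum.elim_inl, Sum.elim_inr]
    omega
  have hstep : ∀ i ≠ i₀, ∃ j, (cell a i : ZMod n) = cell a j + k := by
    intro i hi
    obtain ⟨j, q, hj⟩ := h i hi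
    exact ⟨j, by rw [cell_eq_add ha hj]; simp⟩
  have hclosed : ∀ i, ∃ j, (cell a i : ZMod n) = cell a j + k := by
    intro i
    by_cases hi : i = i₀
    · by_cases h1 : i₀ = Sum.inl T
      · obtain ⟨j, hj⟩ := hstep (Sum.inr T) (by simp [h1])
        exact ⟨j, by rw [hi, h1, hTc, hj]⟩
      by_cases h2 : i₀ = Sum.inr T
      · obtain ⟨j, hj⟩ := hstep (Sum.inl T) (by simp [h2])
        exact ⟨j, by rw [hi, h2, ← hTc, hj]⟩
      obtain ⟨j₁, q₁, hj₁⟩ := h (Sum.inl T) (Ne.symm h1)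
      obtain ⟨j₂, q₂, hj₂⟩ := h (Sum.inr T) (Ne.symm h2)
      have c₁ : (cell a (Sum.inl T) : ZMod n) = cell a j₁ + k := by
        rw [cell_eq_add ha hj₁]; simp
      have c₂ : (cell a (Sum.inr T) : ZMod n) = cell a j₂ + k := by
        rw [cell_eq_add ha hj₂]; simp
      have hne : j₁ ≠ j₂ := by
        rintro rfl
        simp only [Sum.elim_inl, Sum.elim_inr] at hj₁ hj₂
        have e : 2 * y T = n * ((q₁ - q₂ : ℤ) : ℝ) := by push_cast; linarith
        have p1 := hpos T
        have p2 := hlt T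
        have hn0 : (0 : ℝ) < n := by rw [hn]; positivity
        have l1 : ((0 : ℤ) : ℝ) < ((q₁ - q₂ : ℤ) : ℝ) := by
          rw [Int.cast_zero]; by_contra! hc; nlinarith
        have l2 : ((q₁ - q₂ : ℤ) : ℝ) < ((1 : ℤ) : ℝ) := by
          rw [Int.cast_one]; by_contra! hc; nlinarith
        have l1 := Int.cast_lt.1 l1
        have l2 := Int.cast_lt.1 l2
        omega
      have hcol := (hcoll j₁ j₂ hne (add_right_cancel (c₁.symm.trans (hTc.trans c₂)))).1
      exfalso
      refine hk ((ZMod.intCast_zmod_eq_zero_iff_dvd k n).1 ?_)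
      rw [hcol] at c₁
      simp only [cell, Sum.elim_inl, hT] at c₁
      push_cast at c₁
      simpa using c₁
    · exact hstep i hi
  set O : Finset (ZMod n) := Finset.univ.image fun i => (cell a i : ZMod n) with hO
  have hcard : O.card = 2 * m - 1 := by
    have : O = (Finset.univ.erase (Sum.inr T)).image fun i => (cell a i : ZMod n) := by
      refine Finset.Subset.antisymm (fun c hc => ?_) (Finset.image_subset_image (by simp))
      obtain ⟨i, -, rfl⟩ := Finset.mem_image.1 hc
      by_cases hi : i = Sum.inr T
      · exact Finset.mem_image.2 ⟨Sum.inl T, by simp, by rw [hi]; exact hTc⟩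
      · exact Finset.mem_image.2 ⟨i, by simp [hi], rfl⟩
    rw [this, Finset.card_image_of_injOn, Finset.card_erase_of_mem (Finset.mem_univ _)]
    · simp; omega
    · intro i hi j hj hij
      by_contra hne
      rcases (hcoll i j hne hij).2 with h | h
      · simp [h.2] at hj
      · simp [h.1] at hi
  have hsub : O ⊆ O.image fun c => c + (k : ZMod n) := by
    intro c hc
    obtain ⟨i, -, rfl⟩ := Finset.mem_image.1 hc
    obtain ⟨j, hj⟩ := hclosed i
    exact Finset.mem_image.2 ⟨cell a j, Finset.mem_image.2 ⟨j, Finset.mem_univ _, rfl⟩, hj.symm⟩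
  have heq := Finset.eq_of_subset_of_card_le hsub Finset.card_image_le
  have hsum : ∑ c ∈ O, c = ∑ c ∈ O, (c + (k : ZMod n)) := by
    conv_lhs => rw [heq]
    rw [Finset.sum_image fun _ _ _ _ h => add_right_cancel h]
  rw [Finset.sum_add_distrib, Finset.sum_const, hcard, nsmul_eq_mul, left_eq_add,
    ← Int.cast_natCast, ← Int.cast_mul, ZMod.intCast_zmod_eq_zero_iff_dvd] at hsum
  refine hk ((IsCoprime.dvd_of_dvd_mul_left ?_ hsum))
  have hm : 0 < m := T.pos
  have hcop : IsCoprime (n : ℤ) 4 := ⟨if m % 2 = 0 then -1 else 1,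
    if m % 2 = 0 then (m / 2 : ℤ) + 1 else -((m / 2 : ℤ) + 1), by split_ifs <;> omega⟩
  obtain ⟨u, v, huv⟩ := hcop
  exact ⟨u + v, -v, by rw [← huv, hn]; push_cast [show 1 ≤ 2 * m by omega]; ring⟩

/-- If the cells form an initial segment, almost invariance forces the points to be equally
spaced. -/
lemma eq_of_almostInvariant_of_segment {m n : ℕ} (hn : n = 2 * m + 3) {y : Fin m → ℝ}
    (ha : ∀ j : Fin m, (((j : ℕ) : ℤ) : ℝ) < y j ∧ y j < ((j : ℕ) : ℤ) + 1)
    {k : ℤ} (hk0 : 0 < k) (hkn : k < n) (h : AlmostInvariant n y k) (j : Fin m) :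
    y j = (j : ℕ) + 1 / 2 := by
  have hm : 0 < m := j.pos
  set a : Fin m → ℤ := fun j => ((j : ℕ) : ℤ) with hadef
  have hcell : ∀ {i j : Fin m ⊕ Fin m} {k q : ℤ},
      Sum.elim y (fun j => -y j) i = Sum.elim y (fun j => -y j) j + k + n * q →
      cell a i = cell a j + k + n * q := fun h => cell_eq_add ha h
  have hrange : ∀ i, -(m : ℤ) ≤ cell a i ∧ cell a i ≤ m - 1 := by
    rintro (i | i) <;> simp only [cell, a, Sum.elim_inl, Sum.elim_inr] <;>
      constructor <;> have := i.isLt <;> omega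
  have hsurj : ∀ c : ℤ, -(m : ℤ) ≤ c → c ≤ m - 1 → ∃ i, cell a i = c := by
    intro c h1 h2
    rcases le_or_gt 0 c with h | h
    · exact ⟨Sum.inl ⟨c.toNat, by omega⟩, by simp [cell, a, h]⟩
    · refine ⟨Sum.inr ⟨(-c - 1).toNat, by omega⟩, ?_⟩
      simp only [cell, a, Sum.elim_inr]
      omega
  have hinj : Function.Injective (cell a) := by
    rintro (i | i) (j | j) hij <;> simp only [cell, a, Sum.elim_inl, Sum.elim_inr] at hij
    · rw [Fin.ext (by omega : (i : ℕ) = j)]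
    · omega
    · omega
    · rw [Fin.ext (by omega : (i : ℕ) = j)]
  have hqcases : ∀ (k : ℤ), 0 < k → k < n → ∀ i j q, cell a i = cell a j + k + n * q →
      q = 0 ∨ q = -1 := by
    intro k hk0 hkn i j q hq
    have h1 := hrange i
    have h2 := hrange j
    have h3 : q < 1 := by
      by_contra! hc; nlinarith
    have h4 : -2 < q := by
      by_contra! hc; nlinarith
    omega
  have hone : AlmostInvariant n y 1 := by
    by_cases h1 : k = 1
    · rwa [← h1]
    by_cases h2 : k = n - 1
    · have := h.neg
      rwa [h2, sub_sub_cancel] at this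
    exfalso
    obtain ⟨i₀, h⟩ := h
    have hbad : ∀ c, -(m : ℤ) ≤ c → c ≤ m - 1 → k - m - 3 ≤ c → c ≤ k - m - 1 →
        cell a i₀ = c := by
      intro c h1 h2 h3 h4
      obtain ⟨i, rfl⟩ := hsurj c h1 h2
      by_cases hi : i = i₀
      · rw [hi]
      obtain ⟨j, q, hq⟩ := h i hi
      have hq := hcell hq
      have hj := hrange j
      rcases hqcases k hk0 hkn i j q hq with rfl | rfl <;> omega
    by_cases h3 : k = 2
    · have b1 := hbad (k - m - 2) (by omega) (by omega) (by omega) (by omega)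
      have b2 := hbad (k - m - 1) (by omega) (by omega) (by omega) (by omega)
      omega
    · have b1 := hbad (k - m - 3) (by omega) (by omega) (by omega) (by omega)
      have b2 := hbad (k - m - 2) (by omega) (by omega) (by omega) (by omega)
      omega
  obtain ⟨i₀, h1⟩ := hone
  have hi₀ : cell a i₀ = -m := by
    obtain ⟨i, hi⟩ := hsurj (-m) le_rfl (by omega)
    by_cases hii : i = i₀
    · rw [← hii, hi]
    obtain ⟨j, q, hq⟩ := h1 i hii
    have hq := hcell hq
    have hj := hrange j
    rcases hqcases 1 one_pos (by omega) i j q hq with rfl | rfl <;> omega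
  have hstep : ∀ i j, cell a i = cell a j + 1 →
      Sum.elim y (fun j => -y j) i = Sum.elim y (fun j => -y j) j + 1 := by
    intro i j hij
    have hj := hrange j
    obtain ⟨j', q, hq⟩ := h1 i fun h => by rw [h, hi₀] at hij; omega
    have hc := hcell hq
    have hi := hrange i
    have hj' := hrange j'
    rcases hqcases 1 one_pos (by omega) i j' q hc with rfl | rfl
    · have : j' = j := hinj (by omega)
      rw [this] at hq
      rw [hq]
      simp
    · omega
  obtain ⟨j, hj⟩ := j
  induction j with
  | zero =>
    have := hstep (Sum.inl ⟨0, hm⟩) (Sum.inr ⟨0, hm⟩) (by simp [cell, a])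
    simp only [Sum.elim_inl, Sum.elim_inr] at this
    simp only [Nat.cast_zero]
    linarith
  | succ j ih =>
    have := hstep (Sum.inl ⟨j + 1, hj⟩) (Sum.inl ⟨j, by omega⟩) (by simp [cell, a])
    simp only [Sum.elim_inl] at this
    rw [this, ih]
    push_cast
    ring

/-- The points `exp (± i ζ j)` of the unit circle. -/
noncomputable def circlePoint {m : ℕ} (ζ : Fin m → ℝ) (i : Fin m ⊕ Fin m) : ℂ :=
  Complex.exp ((Sum.elim ζ (fun j => -ζ j) i : ℝ) * Complex.I)

lemma almostInvariant_of_rotation {m n k : ℕ} (hn : n ≠ 0) {ζ : Fin m → ℝ}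
    (h : ∃ i₀, ∀ i ≠ i₀, ∃ j, circlePoint ζ i =
      Complex.exp (2 * Real.pi * Complex.I / n) ^ k * circlePoint ζ j) :
    AlmostInvariant n (fun j => n * ζ j / (2 * Real.pi)) k := by
  obtain ⟨i₀, h⟩ := h
  refine ⟨i₀, fun i hi => ?_⟩
  obtain ⟨j, hj⟩ := h i hi
  rw [circlePoint, circlePoint, ← Complex.exp_nat_mul, ← Complex.exp_add,
    Complex.exp_eq_exp_iff_exists_int] at hj
  obtain ⟨q, hq⟩ := hj
  refine ⟨j, q, ?_⟩
  have hscale : ∀ i, Sum.elim (fun j => n * ζ j / (2 * Real.pi))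
      (fun j => -(n * ζ j / (2 * Real.pi))) i =
      n / (2 * Real.pi) * Sum.elim ζ (fun j => -ζ j) i := by
    rintro (i | i) <;> simp only [Sum.elim_inl, Sum.elim_inr] <;> ring
  have hn' : (n : ℝ) ≠ 0 := Nat.cast_ne_zero.2 hn
  have hreal : Sum.elim ζ (fun j => -ζ j) i =
      k * (2 * Real.pi / n) + Sum.elim ζ (fun j => -ζ j) j + q * (2 * Real.pi) := by
    have hn' : (n : ℂ) ≠ 0 := Nat.cast_ne_zero.2 hn
    apply Complex.ofReal_injective
    apply mul_right_cancel₀ Complex.I_ne_zero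
    rw [hq]
    push_cast
    ring
  rw [hscale, hscale, hreal]
  have := Real.pi_ne_zero
  push_cast
  field_simp
  ring

lemma circlePoint_pow_ne_one {m n : ℕ} {ζ : Fin m → ℝ} {a : Fin m → ℤ}
    (ha : ∀ j, (a j : ℝ) < n * ζ j / (2 * Real.pi) ∧ n * ζ j / (2 * Real.pi) < a j + 1)
    (i : Fin m ⊕ Fin m) : circlePoint ζ i ^ n ≠ 1 := by
  intro h
  rw [circlePoint, ← Complex.exp_nat_mul, Complex.exp_eq_one_iff] at h
  obtain ⟨q, hq⟩ := h
  have hreal : n * Sum.elim ζ (fun j => -ζ j) i = q * (2 * Real.pi) := by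
    apply Complex.ofReal_injective
    apply mul_right_cancel₀ Complex.I_ne_zero
    push_cast
    linear_combination hq
  have hint : ∀ (j : Fin m) (q : ℤ), n * ζ j ≠ q * (2 * Real.pi) := by
    intro j q h
    have hj := ha j
    rw [h, mul_div_cancel_right₀ _ (by positivity)] at hj
    have h1 : a j < q := by exact_mod_cast hj.1
    have h2 : q < a j + 1 := by exact_mod_cast hj.2
    omega
  rcases i with i | i
  · exact hint i q hreal
  · refine hint i (-q) ?_
    simp only [Sum.elim_inr] at hreal
    push_cast
    linarith

lemma circlePoint_injective {m : ℕ} {ζ : Fin m → ℝ} (hmono : StrictMono ζ)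
    (hrange : ∀ j, ζ j ∈ Set.Ioo 0 Real.pi) : Function.Injective (circlePoint ζ) := by
  intro i j hij
  rw [circlePoint, circlePoint, Complex.exp_eq_exp_iff_exists_int] at hij
  obtain ⟨q, hq⟩ := hij
  have hreal : Sum.elim ζ (fun j => -ζ j) i =
      Sum.elim ζ (fun j => -ζ j) j + q * (2 * Real.pi) := by
    apply Complex.ofReal_injective
    apply mul_right_cancel₀ Complex.I_ne_zero
    rw [hq]
    push_cast
    ring
  have hb : ∀ i, -Real.pi < Sum.elim ζ (fun j => -ζ j) i ∧
      Sum.elim ζ (fun j => -ζ j) i < Real.pi := by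
    rintro (i | i) <;> have := hrange i <;> simp only [Sum.elim_inl, Sum.elim_inr] <;>
      constructor <;> linarith [this.1, this.2]
  have h1 : ((-1 : ℤ) : ℝ) < q := by
    push_cast; by_contra! hc; nlinarith [hb i, hb j, Real.pi_pos]
  have h2 : (q : ℝ) < ((1 : ℤ) : ℝ) := by
    push_cast; by_contra! hc; nlinarith [hb i, hb j, Real.pi_pos]
  have h1 := Int.cast_lt.1 h1
  have h2 := Int.cast_lt.1 h2
  rw [show q = 0 by omega, Int.cast_zero, zero_mul, add_zero] at hreal
  rcases i with i | i <;> rcases j with j | j <;>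
    simp only [Sum.elim_inl, Sum.elim_inr] at hreal
  · rw [hmono.injective hreal]
  · linarith [(hrange i).1, (hrange j).1]
  · linarith [(hrange i).1, (hrange j).1]
  · rw [hmono.injective (neg_injective hreal)]

open Polynomial in
lemma monic_cosine_factor (c : ℝ) : (X ^ 2 - C (2 * c) * X + 1 : ℝ[X]).Monic := by
  monicity!

open Polynomial in
lemma natDegree_cosine_factor (c : ℝ) : (X ^ 2 - C (2 * c) * X + 1 : ℝ[X]).natDegree = 2 := by
  compute_degree!

open Polynomial in
/-- The product of the factors with conjugate roots `exp (± i ζ j)`. -/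
noncomputable def cosinePoly {m : ℕ} (ζ : Fin m → ℝ) : ℝ[X] :=
  ∏ j, (X ^ 2 - C (2 * Real.cos (ζ j)) * X + 1 : ℝ[X])

lemma natDegree_cosinePoly {m : ℕ} (ζ : Fin m → ℝ) : (cosinePoly ζ).natDegree = 2 * m := by
  rw [cosinePoly, Polynomial.natDegree_prod_of_monic _ _ fun j _ => monic_cosine_factor _]
  simp_rw [natDegree_cosine_factor]
  simp [mul_comm]

lemma coeff_cosinePoly_two_mul {m : ℕ} (ζ : Fin m → ℝ) : (cosinePoly ζ).coeff (2 * m) = 1 := by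
  rw [← natDegree_cosinePoly ζ]
  exact Polynomial.monic_prod_of_monic _ _ fun j _ => monic_cosine_factor _

lemma sum_coeff_cosinePoly_circlePoint {m : ℕ} (ζ : Fin m → ℝ) (i : Fin m ⊕ Fin m) :
    ∑ l ∈ Finset.range (2 * m + 1), ((cosinePoly ζ).coeff l : ℂ) * circlePoint ζ i ^ l = 0 := by
  have h := Polynomial.eval₂_eq_sum_range' Complex.ofRealHom (p := cosinePoly ζ) (n := 2 * m + 1)
    (by rw [natDegree_cosinePoly]; omega) (circlePoint ζ i)
  simp only [Complex.ofRealHom_eq_coe] at h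
  rw [← h, cosinePoly, Polynomial.eval₂_finsetProd]
  have hroot : ∀ (x c : ℝ), Real.cos x = c →
      Complex.exp (x * Complex.I) ^ 2 - 2 * c * Complex.exp (x * Complex.I) + 1 = 0 := by
    rintro x c rfl
    have h1 : Complex.exp (x * Complex.I) * Complex.exp (-x * Complex.I) = 1 := by
      rw [← Complex.exp_add]; simp
    have h2 := Complex.two_cos (x : ℂ)
    rw [Complex.ofReal_cos]
    linear_combination (-Complex.exp (x * Complex.I)) * h2 - h1
  rcases i with i | i <;> refine Finset.prod_eq_zero (Finset.mem_univ i) ?_ <;>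
    simp only [Polynomial.eval₂_add, Polynomial.eval₂_sub, Polynomial.eval₂_mul,
      Polynomial.eval₂_pow, Polynomial.eval₂_X, Polynomial.eval₂_C, Polynomial.eval₂_one,
      circlePoint, Sum.elim_inl, Sum.elim_inr, Complex.ofRealHom_eq_coe, Complex.ofReal_mul,
      Complex.ofReal_ofNat]
  · exact hroot _ _ rfl
  · exact hroot _ _ (Real.cos_neg _)

lemma rootSystem_circlePoint {m n : ℕ} (hn : n = 2 * m + 3) {ζ : Fin m → ℝ}
    (hmono : StrictMono ζ) (hrange : ∀ j, ζ j ∈ Set.Ioo 0 Real.pi) {a : Fin m → ℤ}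
    (ha : ∀ j, (a j : ℝ) < n * ζ j / (2 * Real.pi) ∧ n * ζ j / (2 * Real.pi) < a j + 1) :
    RootSystem n (2 * m) (fun l => ((cosinePoly ζ).coeff l : ℂ)) (circlePoint ζ) Sum.swap where
  hn := hn
  card := by simp; omega
  lead := by simp [coeff_cosinePoly_two_mul]
  inj := circlePoint_injective hmono hrange
  root := sum_coeff_cosinePoly_circlePoint ζ
  ne_zero _ := Complex.exp_ne_zero _
  inv := by rintro (i | i) <;> simp [circlePoint, ← Complex.exp_neg]
  ne_self := by rintro (i | i) <;> simp
  pow_ne := circlePoint_pow_ne_one ha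

lemma exists_cells {m n : ℕ} {ζ : Fin m → ℝ}
    (hfrac : ∀ j : Fin m,
      (Even (j : ℕ) → Int.fract ((n : ℝ) * ζ j / (4 * Real.pi)) ∈ Set.Ioo (0 : ℝ) (1/2)) ∧
      (Odd (j : ℕ) → Int.fract ((n : ℝ) * ζ j / (4 * Real.pi)) ∈ Set.Ioo (1/2 : ℝ) 1)) :
    ∃ a : Fin m → ℤ,
      (∀ j, (a j : ℝ) < n * ζ j / (2 * Real.pi) ∧ n * ζ j / (2 * Real.pi) < a j + 1) ∧
      ∀ j : Fin m, (a j - (j : ℕ)) % 2 = 0 := by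
  have : ∀ j : Fin m, ∃ a : ℤ, ((a : ℝ) < n * ζ j / (2 * Real.pi) ∧
      n * ζ j / (2 * Real.pi) < a + 1) ∧ (a - (j : ℕ)) % 2 = 0 := by
    intro j
    have h2 : n * ζ j / (2 * Real.pi) = 2 * ((n : ℝ) * ζ j / (4 * Real.pi)) := by ring
    have h3 := Int.floor_add_fract ((n : ℝ) * ζ j / (4 * Real.pi))
    rw [h2]
    rcases Nat.even_or_odd (j : ℕ) with hj | hj
    · obtain ⟨h4, h5⟩ := (hfrac j).1 hj
      refine ⟨2 * ⌊(n : ℝ) * ζ j / (4 * Real.pi)⌋, ?_, by obtain ⟨r, hr⟩ := hj; omega⟩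
      push_cast
      constructor <;> linarith
    · obtain ⟨h4, h5⟩ := (hfrac j).2 hj
      refine ⟨2 * ⌊(n : ℝ) * ζ j / (4 * Real.pi)⌋ + 1, ?_, by obtain ⟨r, hr⟩ := hj; omega⟩
      push_cast
      constructor <;> linarith
  choose a ha using this
  exact ⟨a, fun j => (ha j).1, fun j => (ha j).2⟩

/-- The integer-indexed periodic extension of a matrix. -/
def periodicExtension {n : ℕ} [NeZero n] (A : Matrix (Fin n) (Fin n) ℝ) (a b : ℤ) : ℂ :=
  (A (Fin.ofNat n (a % n).toNat) (Fin.ofNat n (b % n).toNat) : ℝ)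

lemma ofNat_emod_eq_circEmb {n : ℕ} [NeZero n] (j : ℤ) (s : Fin (n - 2)) :
    Fin.ofNat n ((j + (s : ℕ)) % n).toNat = circEmb n (Fin.ofNat n (j % n).toNat) s := by
  have hn : (0 : ℤ) < n := by exact_mod_cast Nat.pos_of_neZero n
  apply Fin.ext
  simp only [circEmb, Fin.val_add, Fin.val_ofNat, Fin.val_castLE]
  zify
  rw [Int.toNat_of_nonneg (Int.emod_nonneg _ hn.ne'),
    Int.toNat_of_nonneg (Int.emod_nonneg _ hn.ne')]
  simp

lemma cyclicKernel_periodicExtension {n N : ℕ} [NeZero n] (hN : n = N + 3) {w : ℕ → ℝ}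
    {A : Matrix (Fin n) (Fin n) ℝ} (hA : A.IsSymm)
    (h : ∀ (j : Fin n) (s : Fin (n - 2)),
      ∑ l : Fin (n - 2), A (circEmb n j s) (circEmb n j l) * w l = 0) :
    CyclicKernel n N (fun l => (w l : ℂ)) (periodicExtension A) where
  periodic a b := by simp [periodicExtension]
  symm a b := by rw [periodicExtension, periodicExtension, hA.apply]
  annihilates j s hs := by
    have := h (Fin.ofNat n (j % n).toNat) ⟨s, by omega⟩
    simp_rw [← ofNat_emod_eq_circEmb] at this
    rw [Fin.sum_univ_eq_sum_range (fun l => A (Fin.ofNat n ((j + (s : ℕ)) % n).toNat)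
      (Fin.ofNat n ((j + (l : ℕ)) % n).toNat) * w l), show n - 2 = N + 1 by omega] at this
    simp only [periodicExtension]
    exact_mod_cast this

lemma coeff_zero_one_prod {ι : Type*} (S : Finset ι) (c : ι → ℝ) :
    (∏ j ∈ S, (Polynomial.X ^ 2 - Polynomial.C (2 * c j) * Polynomial.X + 1)).coeff 0 = 1 ∧
    (∏ j ∈ S, (Polynomial.X ^ 2 - Polynomial.C (2 * c j) * Polynomial.X + 1)).coeff 1 =
      -2 * ∑ j ∈ S, c j := by
  classical
  induction S using Finset.induction_on with
  | empty => simp [Polynomial.coeff_one]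
  | insert j S hj ih =>
    rw [Finset.prod_insert hj, Finset.sum_insert hj, Polynomial.mul_coeff_zero,
      Polynomial.mul_coeff_one, ih.1, ih.2]
    simp [Polynomial.coeff_one, Polynomial.coeff_X_pow]
    ring

lemma sum_cos_pos {m n : ℕ} (hn : n = 2 * m + 3) (hm : 0 < m) :
    0 < ∑ j : Fin m, Real.cos ((2 * (j : ℕ) + 1 : ℝ) * Real.pi / n) := by
  have : NeZero m := ⟨hm.ne'⟩
  have hpair : 0 < ∑ j : Fin m, (Real.cos ((2 * (j : ℕ) + 1 : ℝ) * Real.pi / n) +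
      Real.cos ((2 * ((Fin.rev j : Fin m) : ℕ) + 1 : ℝ) * Real.pi / n)) := by
    refine Finset.sum_pos (fun j _ => ?_) Finset.univ_nonempty
    have hn0 : (0 : ℝ) < n := by rw [hn]; positivity
    have hn' : (n : ℝ) = 2 * m + 3 := by rw [hn]; push_cast; ring
    have hr : ((Fin.rev j : Fin m) : ℕ) + ((j : ℕ) : ℝ) + 1 = (m : ℝ) := by
      rw [Fin.val_rev]
      have := j.isLt
      push_cast [Nat.cast_sub (show (j : ℕ) + 1 ≤ m by omega)]
      ring
    set r : ℝ := (((Fin.rev j : Fin m) : ℕ) : ℝ)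
    have hr0 : 0 ≤ r := Nat.cast_nonneg _
    have hj0 : (0 : ℝ) ≤ (j : ℕ) := Nat.cast_nonneg _
    have hpi := Real.pi_pos
    rw [Real.cos_add_cos]
    have hb : ∀ x : ℝ, -n < x → x < n → 0 < Real.cos (x * Real.pi / (2 * n)) := by
      intro x h1 h2
      refine Real.cos_pos_of_mem_Ioo ⟨?_, ?_⟩
      · rw [lt_div_iff₀ (by positivity)]; nlinarith
      · rw [div_lt_iff₀ (by positivity)]; nlinarith
    have h1 := hb (2 * (j : ℕ) + 1 + (2 * r + 1)) (by linarith) (by linarith)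
    have h2 := hb (2 * (j : ℕ) + 1 - (2 * r + 1)) (by linarith) (by linarith)
    refine mul_pos (mul_pos two_pos ?_) ?_
    · rwa [← add_div, ← add_mul, div_div, mul_comm (n : ℝ)]
    · rwa [← sub_div, ← sub_mul, div_div, mul_comm (n : ℝ)]
  have hrev := Equiv.sum_comp Fin.revPerm
    fun j : Fin m => Real.cos ((2 * (j : ℕ) + 1 : ℝ) * Real.pi / n)
  simp only [Fin.revPerm_apply] at hrev
  rw [Finset.sum_add_distrib, hrev] at hpair
  linarith

/-- Under the interlacing condition, two linearly independent matrices force the angles to be the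
odd multiples of `π / n`. -/
lemma angles_eq_of_linearIndependent {m n : ℕ} (hn : n = 2 * m + 3) {ζ : Fin m → ℝ}
    (hmono : StrictMono ζ) (hrange : ∀ j, ζ j ∈ Set.Ioo 0 Real.pi)
    (hfrac : ∀ j : Fin m,
      (Even (j : ℕ) → Int.fract ((n : ℝ) * ζ j / (4 * Real.pi)) ∈ Set.Ioo (0 : ℝ) (1/2)) ∧
      (Odd (j : ℕ) → Int.fract ((n : ℝ) * ζ j / (4 * Real.pi)) ∈ Set.Ioo (1/2 : ℝ) 1))
    {A B : Matrix (Fin n) (Fin n) ℝ} (hA : A.IsSymm) (hB : B.IsSymm)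
    (hAu : ∀ (j : Fin n) (s : Fin (n - 2)),
      ∑ l : Fin (n - 2), A (circEmb n j s) (circEmb n j l) * (cosinePoly ζ).coeff l = 0)
    (hBu : ∀ (j : Fin n) (s : Fin (n - 2)),
      ∑ l : Fin (n - 2), B (circEmb n j s) (circEmb n j l) * (cosinePoly ζ).coeff l = 0)
    (hind : LinearIndependent ℝ ![A, B]) (j : Fin m) :
    ζ j = (2 * (j : ℕ) + 1 : ℝ) * Real.pi / n := by
  have hm : 0 < m := j.pos
  have : NeZero n := ⟨by omega⟩
  have : Nonempty (Fin m ⊕ Fin m) := ⟨Sum.inl j⟩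
  have hn0 : (0 : ℝ) < n := by rw [hn]; positivity
  have hpi := Real.pi_pos
  obtain ⟨a, ha, hpar⟩ := exists_cells hfrac
  have hR := rootSystem_circlePoint hn hmono hrange ha
  obtain ⟨k, hk0, hkn, hrot⟩ := CyclicKernel.exists_rotation hR (by omega)
    (cyclicKernel_periodicExtension hn hA hAu) (cyclicKernel_periodicExtension hn hB hBu)
    (Complex.isPrimitiveRoot_exp n (by omega)) (by
      intro α β h
      rw [LinearIndependent.pair_iff] at hind
      have hentry : ∀ p q : Fin n, α * (A p q : ℂ) + β * (B p q : ℂ) = 0 := by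
        intro p q
        have := h ((p : ℕ) : ℤ) ((q : ℕ) : ℤ)
        have hp : ∀ p : Fin n, Fin.ofNat n (((p : ℕ) : ℤ) % n).toNat = p := fun p => by
          rw [← Int.natCast_mod, Int.toNat_natCast, Nat.mod_eq_of_lt p.isLt]
          exact Fin.ofNat_val_eq_self p
        rwa [periodicExtension, periodicExtension, hp, hp] at this
      have hre := hind α.re β.re (by
        ext p q
        simpa using congrArg Complex.re (hentry p q))
      have him := hind α.im β.im (by
        ext p q
        simpa using congrArg Complex.im (hentry p q))
      exact ⟨Complex.ext hre.1 him.1, Complex.ext hre.2 him.2⟩)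
  have hinv := almostInvariant_of_rotation (by omega) hrot
  have hy : StrictMono fun j => n * ζ j / (2 * Real.pi) := fun i j hij => by
    have := hmono hij
    dsimp only
    gcongr
  have hpos : ∀ j, 0 < n * ζ j / (2 * Real.pi) := fun j => by
    have := (hrange j).1
    positivity
  have hlt : ∀ j, n * ζ j / (2 * Real.pi) < n / 2 := fun j => by
    rw [div_lt_div_iff₀ (by positivity) two_pos]
    nlinarith [(hrange j).2]
  obtain ⟨hamono, hbound, hseg | ⟨T, hT⟩⟩ := cells_alternative hn hy ha hpar hpos hlt
  · have hy := eq_of_almostInvariant_of_segment hn (fun j => by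
      have := ha j
      rwa [hseg j] at this) (by exact_mod_cast hk0) (by exact_mod_cast hkn) hinv j
    rw [div_eq_iff (by positivity)] at hy
    rw [eq_div_iff hn0.ne', mul_comm, hy]
    ring
  · refine absurd hinv (not_almostInvariant_of_central hn ha hamono hbound hpos hlt hT ?_)
    intro h
    have := Int.le_of_dvd (by exact_mod_cast hk0) h
    omega

open Polynomial in
theorem statement19 (n : ℕ) (hn : 5 ≤ n) (hodd : Odd n)
    (ζ : Fin ((n - 3) / 2) → ℝ) (hmono : StrictMono ζ)
    (hrange : ∀ j, ζ j ∈ Set.Ioo 0 Real.pi)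
    (hfrac : ∀ j : Fin ((n - 3) / 2),
      (Even (j : ℕ) → Int.fract ((n : ℝ) * ζ j / (4 * Real.pi)) ∈ Set.Ioo (0 : ℝ) (1/2)) ∧
      (Odd (j : ℕ) → Int.fract ((n : ℝ) * ζ j / (4 * Real.pi)) ∈ Set.Ioo (1/2 : ℝ) 1))
    (u : Fin (n - 2) → ℝ)
    (hu : ∀ l : Fin (n - 2),
      u l = (∏ j : Fin ((n - 3) / 2),
        (X ^ 2 - C (2 * Real.cos (ζ j)) * X + 1 : ℝ[X])).coeff (l : ℕ))
    (hdim : ∃ A B : Matrix (Fin n) (Fin n) ℝ,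
      (A.IsSymm ∧ ∀ (j : Fin n) (s : Fin (n - 2)),
        ∑ l : Fin (n - 2), A (circEmb n j s) (circEmb n j l) * u l = 0) ∧
      (B.IsSymm ∧ ∀ (j : Fin n) (s : Fin (n - 2)),
        ∑ l : Fin (n - 2), B (circEmb n j s) (circEmb n j l) * u l = 0) ∧
      LinearIndependent ℝ ![A, B]) :
    (∀ j : Fin ((n - 3) / 2), ζ j = (2 * (j : ℕ) + 1 : ℝ) * Real.pi / n) ∧
    ∃ l, u l < 0 := by
  obtain ⟨A, B, ⟨hA, hAu⟩, ⟨hB, hBu⟩, hind⟩ := hdim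
  have hn3 : n = 2 * ((n - 3) / 2) + 3 := by
    obtain ⟨r, hr⟩ := hodd
    omega
  have hu' : ∀ l : Fin (n - 2), u l = (cosinePoly ζ).coeff l := hu
  simp_rw [hu'] at hAu hBu
  have hζ := angles_eq_of_linearIndependent hn3 hmono hrange hfrac hA hB hAu hBu hind
  refine ⟨hζ, ⟨1, by omega⟩, ?_⟩
  have hpos := sum_cos_pos hn3 (by omega)
  rw [hu, (coeff_zero_one_prod _ _).2]
  simp_rw [hζ]
  linarith
end
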